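/- arXiv:2106.07320 — 4 statements merged into one kernel-verified Lean document; each statement's English description precedes it below -/
import Mathlib

section
/- For every symmetric positive definite 2n×2n real matrix S there exist a matrix F ∈ Aut(𝔠𝔥(n)) and admissible parameters (p, x, σ, β) such that FᵀSF = S(p, x, σ, β). (Classification theorem, existence part: every positive definite inner product on 𝔠𝔥(n) is equivalent under the automorphism group to one of the normal forms S(p, x, σ, β).) -/
noncomputable section

open Matrix BigOperators Finset

namespace CHn

/-- Structure constants of the Lie algebra 𝔠𝔥(n) in the ordered basis
`(X, Y_1, …, Y_{n-1}, Z_1, …, Z_{n-1}, W)`: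
index `0 ↦ X`, indices `1,…,n-1 ↦ Y_1,…,Y_{n-1}`,
indices `n,…,2n-2 ↦ Z_1,…,Z_{n-1}`, index `2n-1 ↦ W`.
The nonzero brackets are `[X,Y_i] = (1/2)Y_i`, `[X,Z_i] = (1/2)Z_i`,
`[X,W] = W`, `[Z_j,Y_i] = δ_{ij} W`. -/
def structC (n : ℕ) (i j k : Fin (2 * n)) : ℝ :=
  (if i.val = 0 ∧ j = k ∧ 1 ≤ j.val ∧ j.val ≤ 2 * n - 2 then (1 : ℝ) / 2 else 0)
  - (if j.val = 0 ∧ i = k ∧ 1 ≤ i.val ∧ i.val ≤ 2 * n - 2 then (1 : ℝ) / 2 else 0)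
  + (if i.val = 0 ∧ j.val = 2 * n - 1 ∧ k.val = 2 * n - 1 then (1 : ℝ) else 0)
  - (if j.val = 0 ∧ i.val = 2 * n - 1 ∧ k.val = 2 * n - 1 then (1 : ℝ) else 0)
  + (if n ≤ i.val ∧ i.val ≤ 2 * n - 2 ∧ i.val = j.val + (n - 1) ∧ k.val = 2 * n - 1
      then (1 : ℝ) else 0)
  - (if n ≤ j.val ∧ j.val ≤ 2 * n - 2 ∧ j.val = i.val + (n - 1) ∧ k.val = 2 * n - 1
      then (1 : ℝ) else 0)

/-- The Lie bracket of `𝔠𝔥(n)`, as a bilinear operation on coordinate vectors. -/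
def bracket (n : ℕ) (u v : Fin (2 * n) → ℝ) : Fin (2 * n) → ℝ :=
  fun k => ∑ i, ∑ j, u i * v j * structC n i j k

/-- `F` is the matrix (in the ordered basis) of a Lie algebra automorphism of `𝔠𝔥(n)`. -/
def IsAut (n : ℕ) (F : Matrix (Fin (2 * n)) (Fin (2 * n)) ℝ) : Prop :=
  IsUnit F ∧ ∀ u v, F.mulVec (bracket n u v) = bracket n (F.mulVec u) (F.mulVec v)

/-- The normal form `S(p, x, σ, β)`: the block matrix
`[[p, xᵀ, 0, 0], [x, σ, 0, 0], [0, 0, σ, 0], [0, 0, 0, β]]`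
with blocks of sizes `1, n-1, n-1, 1`. -/
def Sform (n : ℕ) (p : ℝ) (x σ : Fin (n - 1) → ℝ) (β : ℝ) :
    Matrix (Fin (2 * n)) (Fin (2 * n)) ℝ := fun i j =>
  if i.val = 0 ∧ j.val = 0 then p
  else if h : i.val = 0 ∧ 1 ≤ j.val ∧ j.val ≤ n - 1 then x ⟨j.val - 1, by omega⟩
  else if h : j.val = 0 ∧ 1 ≤ i.val ∧ i.val ≤ n - 1 then x ⟨i.val - 1, by omega⟩
  else if h : i = j ∧ 1 ≤ i.val ∧ i.val ≤ n - 1 then σ ⟨i.val - 1, by omega⟩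
  else if h : i = j ∧ n ≤ i.val ∧ i.val ≤ 2 * n - 2 then σ ⟨i.val - n, by omega⟩
  else if i = j ∧ i.val = 2 * n - 1 then β
  else 0

/-- Admissibility of the parameters `(p, x, σ, β)`:
`p, β > 0`, all `x_i ≥ 0`, `σ_1 ≥ … ≥ σ_{n-2} ≥ 1` and the convention `σ_{n-1} = 1`. -/
def Admissible (n : ℕ) (p : ℝ) (x σ : Fin (n - 1) → ℝ) (β : ℝ) : Prop :=
  0 < p ∧ 0 < β ∧ (∀ i, 0 ≤ x i) ∧ Antitone σ ∧ (∀ i, 1 ≤ σ i) ∧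
    ∀ _h : 1 ≤ n - 1, σ ⟨n - 2, by omega⟩ = 1

/-- `z = p - Σ_i x_i² / σ_i`. -/
def zval (n : ℕ) (p : ℝ) (x σ : Fin (n - 1) → ℝ) : ℝ :=
  p - ∑ i, (x i) ^ 2 / σ i

/-- The inner product on `𝔠𝔥(n)` determined by a matrix `S`. -/
def ip (n : ℕ) (S : Matrix (Fin (2 * n)) (Fin (2 * n)) ℝ) (u v : Fin (2 * n) → ℝ) : ℝ :=
  u ⬝ᵥ S.mulVec v

/-- The coordinates (w.r.t. the standard basis) of the Koszul form
`K(u,v)(T) = ⟨[u,v],T⟩ - ⟨[v,T],u⟩ + ⟨[T,u],v⟩`. -/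
def koszul (n : ℕ) (S : Matrix (Fin (2 * n)) (Fin (2 * n)) ℝ)
    (u v : Fin (2 * n) → ℝ) : Fin (2 * n) → ℝ := fun t =>
  ip n S (bracket n u v) (Pi.single t 1) - ip n S (bracket n v (Pi.single t 1)) u
    + ip n S (bracket n (Pi.single t 1) u) v

/-- The Levi-Civita product `∇_u v` of the inner product `S`,
i.e. the unique solution of the Koszul formula `2⟨∇_u v, T⟩ = K(u,v)(T)`
(for invertible symmetric `S`). -/
def nabla (n : ℕ) (S : Matrix (Fin (2 * n)) (Fin (2 * n)) ℝ)
    (u v : Fin (2 * n) → ℝ) : Fin (2 * n) → ℝ :=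
  (2 : ℝ)⁻¹ • (S⁻¹).mulVec (koszul n S u v)

/-- The curvature operator `R(u,v)w = ∇_u∇_v w - ∇_v∇_u w - ∇_{[u,v]} w`. -/
def curv (n : ℕ) (S : Matrix (Fin (2 * n)) (Fin (2 * n)) ℝ)
    (u v w : Fin (2 * n) → ℝ) : Fin (2 * n) → ℝ :=
  nabla n S u (nabla n S v w) - nabla n S v (nabla n S u w) - nabla n S (bracket n u v) w

/-- The Ricci form `Ric(u,v) = tr (T ↦ R(T,u)v)`. -/
def ricci (n : ℕ) (S : Matrix (Fin (2 * n)) (Fin (2 * n)) ℝ)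
    (u v : Fin (2 * n) → ℝ) : ℝ :=
  ∑ t, curv n S (Pi.single t 1) u v t

/-- The scalar curvature `τ = Σ_{i,j} g^{ij} Ric(e_i, e_j)`. -/
def scalarCurv (n : ℕ) (S : Matrix (Fin (2 * n)) (Fin (2 * n)) ℝ) : ℝ :=
  ∑ i, ∑ j, (S⁻¹) i j * ricci n S (Pi.single i 1) (Pi.single j 1)

/-- The wedge endomorphism `(u∧v)(w) = ⟨v,w⟩u - ⟨u,w⟩v`. -/
def wedge (n : ℕ) (S : Matrix (Fin (2 * n)) (Fin (2 * n)) ℝ)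
    (u v : Fin (2 * n) → ℝ) : (Fin (2 * n) → ℝ) → (Fin (2 * n) → ℝ) :=
  fun w => ip n S v w • u - ip n S u w • v

/-- The standard symplectic matrix `J_m = [[0, I_m], [-I_m, 0]]`. -/
def Jmat (m : ℕ) : Matrix (Fin (2 * m)) (Fin (2 * m)) ℝ := fun i j =>
  if j.val = i.val + m then 1 else if i.val = j.val + m then -1 else 0

/-- The block matrix `[[1, 0, 0], [u, M, 0], [a, vᵀ, λ]]`
with blocks of sizes `1, 2n-2, 1`. -/
def blockF (n : ℕ) (M : Matrix (Fin (2 * (n - 1))) (Fin (2 * (n - 1))) ℝ)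
    (u v : Fin (2 * (n - 1)) → ℝ) (a lam : ℝ) :
    Matrix (Fin (2 * n)) (Fin (2 * n)) ℝ := fun i j =>
  if i.val = 0 then (if j.val = 0 then 1 else 0)
  else if h : 1 ≤ i.val ∧ i.val ≤ 2 * n - 2 then
    (if j.val = 0 then u ⟨i.val - 1, by omega⟩
     else if h2 : 1 ≤ j.val ∧ j.val ≤ 2 * n - 2 then
       M ⟨i.val - 1, by omega⟩ ⟨j.val - 1, by omega⟩
     else 0)
  else
    (if j.val = 0 then a
     else if h2 : 1 ≤ j.val ∧ j.val ≤ 2 * n - 2 then v ⟨j.val - 1, by omega⟩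
     else lam)

/-- The metric is Einstein: the Ricci form is proportional to the inner product. -/
def IsEinstein (n : ℕ) (S : Matrix (Fin (2 * n)) (Fin (2 * n)) ℝ) : Prop :=
  ∃ c : ℝ, ∀ u v, ricci n S u v = c * ip n S u v

end CHn

namespace CHn


/-- Rotation in a plane: a unit pair making a functional nonnegative and zero. -/
lemma exists_rot (a b : ℝ) : ∃ c s : ℝ, c ^ 2 + s ^ 2 = 1 ∧ 0 ≤ c * a + s * b ∧ c * b - s * a = 0 := by
  by_cases h : a ^ 2 + b ^ 2 = 0
  · have ha : a = 0 := by nlinarith [sq_nonneg a, sq_nonneg b]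
    have hb : b = 0 := by nlinarith [sq_nonneg a, sq_nonneg b]
    exact ⟨1, 0, by simp [ha, hb]⟩
  · have hp : 0 < a ^ 2 + b ^ 2 := lt_of_le_of_ne (by positivity) (Ne.symm h)
    set r := Real.sqrt (a ^ 2 + b ^ 2) with hr
    have hr0 : 0 < r := Real.sqrt_pos.2 hp
    have hr2 : r ^ 2 = a ^ 2 + b ^ 2 := Real.sq_sqrt hp.le
    refine ⟨a / r, b / r, ?_, ?_, ?_⟩
    · field_simp; linarith
    · have : a / r * a + b / r * b = (a ^ 2 + b ^ 2) / r := by ring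
      rw [this]; positivity
    · ring

universe u

open scoped RealInnerProductSpace in
theorem skew_normal (m : ℕ) : ∀ (V : Type u) [NormedAddCommGroup V] [InnerProductSpace ℝ V]
    [FiniteDimensional ℝ V] (K : V →ₗ[ℝ] V) (q : V →ₗ[ℝ] ℝ),
    (∀ v w, ⟪K v, w⟫ = - ⟪v, K w⟫) → (∀ v, K v = 0 → v = 0) → Module.finrank ℝ V = 2 * m →
    ∃ (b c : Fin m → V) (μ : Fin m → ℝ), (∀ i, 0 < μ i) ∧
      (∀ i j, ⟪b i, b j⟫ = if i = j then 1 else 0) ∧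
      (∀ i j, ⟪c i, c j⟫ = if i = j then 1 else 0) ∧
      (∀ i j, ⟪b i, c j⟫ = 0) ∧
      (∀ i, K (b i) = μ i • c i) ∧ (∀ i, K (c i) = - μ i • b i) ∧
      (∀ i, 0 ≤ q (b i)) ∧ (∀ i, q (c i) = 0) := by
  induction m with
  | zero =>
    intro V _ _ _ K q _ _ _
    exact ⟨Fin.elim0, Fin.elim0, Fin.elim0, by simp⟩
  | succ m ih =>
    intro V _ _ _ K q hK hinj hdim
    have hnt : Nontrivial V := Module.nontrivial_of_finrank_pos (R := ℝ) (by omega)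
    have hT : (-(K ∘ₗ K)).IsSymmetric := by
      intro v w
      simp [hK]
    obtain ⟨t, ht⟩ : ∃ t, Module.End.HasEigenvalue (-(K ∘ₗ K)) t :=
      ⟨_, hT.hasEigenvalue_iSup_of_finiteDimensional⟩
    obtain ⟨e0, he0⟩ := ht.exists_hasEigenvector
    have he0n : e0 ≠ 0 := he0.2
    have hKKe0 : K (K e0) = - t • e0 := by
      have := he0.apply_eq_smul
      simp at this
      rw [neg_smul, ← this, neg_neg]
    -- normalise
    obtain ⟨e, hee, hKKe⟩ : ∃ e : V, ⟪e, e⟫ = 1 ∧ K (K e) = - t • e := by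
      refine ⟨(‖e0‖)⁻¹ • e0, ?_, ?_⟩
      · have : ‖e0‖ ≠ 0 := norm_ne_zero_iff.2 he0n
        rw [real_inner_smul_left, real_inner_smul_right, real_inner_self_eq_norm_sq]
        field_simp
      · simp [hKKe0]; rw [smul_comm]
    have hen : e ≠ 0 := by rintro rfl; simp at hee
    have htK : t = ⟪K e, K e⟫ := by
      rw [hK, hKKe, inner_smul_right, hee]; ring
    have htpos : 0 < t := by
      rw [htK]
      exact real_inner_self_pos.2 fun h => hen (hinj _ h)
    set μ := Real.sqrt t with hμ
    have hμ0 : 0 < μ := Real.sqrt_pos.2 htpos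
    have hμ2 : μ * μ = t := Real.mul_self_sqrt htpos.le
    obtain ⟨f, hf⟩ : ∃ f, f = μ⁻¹ • K e := ⟨_, rfl⟩
    have hKe : K e = μ • f := by rw [hf, smul_smul, mul_inv_cancel₀ hμ0.ne', one_smul]
    have hKf : K f = - μ • e := by
      rw [hf, map_smul, hKKe, smul_smul, ← hμ2]; congr 1; field_simp
    have hskew : ∀ v, ⟪K v, v⟫ = 0 := by
      intro v
      have := hK v v
      rw [real_inner_comm (K v) v] at this
      linarith [real_inner_comm (K v) v]
    have hef : ⟪e, f⟫ = 0 := by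
      rw [hf, inner_smul_right, real_inner_comm, hskew, mul_zero]
    have hff : ⟪f, f⟫ = 1 := by
      rw [hf, inner_smul_right, inner_smul_left, ← htK, ← hμ2]; simp; field_simp
    have hfe : ⟪f, e⟫ = 0 := by rw [real_inner_comm]; exact hef
    obtain ⟨C, s, hcs, hq1, hq2⟩ := exists_rot (q e) (q f)
    obtain ⟨b, hb⟩ : ∃ b, b = C • e + s • f := ⟨_, rfl⟩
    obtain ⟨c, hc⟩ : ∃ c, c = C • f - s • e := ⟨_, rfl⟩
    have hbb : ⟪b, b⟫ = 1 := by
      simp only [hb, inner_add_left, inner_add_right, real_inner_smul_left, real_inner_smul_right, hee, hff, hef, hfe]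
      linarith
    have hcc : ⟪c, c⟫ = 1 := by
      simp only [hc, inner_sub_left, inner_sub_right, real_inner_smul_left, real_inner_smul_right, hee, hff, hef, hfe]
      linarith
    have hbc : ⟪b, c⟫ = 0 := by
      simp only [hb, hc, inner_add_left, inner_sub_right, real_inner_smul_left, real_inner_smul_right, hee, hff, hef, hfe]
      ring
    have hcb : ⟪c, b⟫ = 0 := by rw [real_inner_comm]; exact hbc
    have hKb : K b = μ • c := by
      simp only [hb, hc, map_add, map_smul, hKe, hKf]; module
    have hKc : K c = - μ • b := by
      simp only [hb, hc, map_sub, map_smul, hKe, hKf]; module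
    have hqb : 0 ≤ q b := by simpa [hb] using hq1
    have hqc : q c = 0 := by simpa [hc] using hq2
    -- complement
    set W : Submodule ℝ V := Submodule.span ℝ (Set.range ![b, c]) with hW
    have hWr : Module.finrank ℝ W = 2 := by
      have hon : Orthonormal ℝ ![b, c] := by
        rw [orthonormal_iff_ite]
        intro i j
        fin_cases i <;> fin_cases j
        · exact hbb
        · exact hbc
        · exact hcb
        · exact hcc
      simpa using finrank_span_eq_card hon.linearIndependent
    have hUr : Module.finrank ℝ Wᗮ = 2 * m := by
      have := W.finrank_add_finrank_orthogonal
      omega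
    have hmem : ∀ v, v ∈ Wᗮ ↔ ⟪b, v⟫ = 0 ∧ ⟪c, v⟫ = 0 := by
      intro v
      rw [hW, ← Submodule.span_singleton_le_iff_mem (R := ℝ), ← Submodule.isOrtho_iff_le.trans Iff.rfl]
      rw [Submodule.isOrtho_comm, Submodule.isOrtho_span]
      simp [and_comm]
    have hKU : ∀ v ∈ Wᗮ, K v ∈ Wᗮ := by
      intro v hv
      rw [hmem] at hv ⊢
      constructor
      · have := hK b v
        rw [hKb, inner_smul_left, hv.2] at this
        simpa using this
      · have := hK c v
        rw [hKc, inner_smul_left, hv.1] at this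
        simpa using this
    obtain ⟨b', c', μ', h1, h2, h3, h4, h5, h6, h7, h8⟩ :=
      ih Wᗮ (K.restrict hKU) (q ∘ₗ Wᗮ.subtype) (by
        intro v w
        simpa using hK v w) (by
        intro v hv
        have := congrArg Subtype.val hv
        simp at this
        exact Subtype.ext (hinj _ this)) hUr
    have hb'1 := fun i => ((hmem _).1 (b' i).2).1
    have hb'2 := fun i => ((hmem _).1 (b' i).2).2
    have hc'1 := fun i => ((hmem _).1 (c' i).2).1
    have hc'2 := fun i => ((hmem _).1 (c' i).2).2
    have hb'3 : ∀ i, ⟪(b' i : V), b⟫ = 0 := fun i => by rw [real_inner_comm]; exact hb'1 i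
    have hb'4 : ∀ i, ⟪(b' i : V), c⟫ = 0 := fun i => by rw [real_inner_comm]; exact hb'2 i
    have hc'4 : ∀ i, ⟪(c' i : V), c⟫ = 0 := fun i => by rw [real_inner_comm]; exact hc'2 i
    simp only [Submodule.coe_inner] at h2 h3 h4
    refine ⟨Fin.cons b fun i => b' i, Fin.cons c fun i => c' i, Fin.cons μ μ', ?_, ?_, ?_, ?_, ?_, ?_, ?_, ?_⟩
    · simp only [Fin.forall_fin_succ, Fin.cons_zero, Fin.cons_succ]; exact ⟨hμ0, h1⟩
    · simp only [Fin.forall_fin_succ, Fin.cons_zero, Fin.cons_succ, hbb, hb'1, hb'3, h2]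
      simp [Fin.succ_ne_zero, (Fin.succ_ne_zero _).symm]
    · simp only [Fin.forall_fin_succ, Fin.cons_zero, Fin.cons_succ, hcc, hc'2, hc'4, h3]
      simp [Fin.succ_ne_zero, (Fin.succ_ne_zero _).symm]
    · simp only [Fin.forall_fin_succ, Fin.cons_zero, Fin.cons_succ, hbc, hc'1, hb'4, h4]
      simp
    · simp only [Fin.forall_fin_succ, Fin.cons_zero, Fin.cons_succ]
      refine ⟨hKb, fun i => ?_⟩
      simpa using congrArg Subtype.val (h5 i)
    · simp only [Fin.forall_fin_succ, Fin.cons_zero, Fin.cons_succ]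
      refine ⟨hKc, fun i => ?_⟩
      simpa using congrArg Subtype.val (h6 i)
    · simp only [Fin.forall_fin_succ, Fin.cons_zero, Fin.cons_succ]; exact ⟨hqb, h7⟩
    · simp only [Fin.forall_fin_succ, Fin.cons_zero, Fin.cons_succ]; exact ⟨hqc, h8⟩

/-- Williamson normal form with a functional, for bilinear forms. -/
theorem williamson (m : ℕ) (hm : 1 ≤ m) (V : Type u) [AddCommGroup V] [Module ℝ V] [FiniteDimensional ℝ V]
    (hdim : Module.finrank ℝ V = 2 * m)
    (g ω : V →ₗ[ℝ] V →ₗ[ℝ] ℝ) (q : V →ₗ[ℝ] ℝ)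
    (hgs : ∀ v w, g v w = g w v) (hgp : ∀ v, v ≠ 0 → 0 < g v v)
    (hω : ∀ v w, ω v w = - ω w v) (hωn : ∀ v, (∀ w, ω v w = 0) → v = 0) :
    ∃ (y z : Fin m → V) (σ : Fin m → ℝ) (lam : ℝ), 0 < lam ∧ Antitone σ ∧ (∀ i, 1 ≤ σ i) ∧
      σ ⟨m - 1, by omega⟩ = 1 ∧
      (∀ i j, g (y i) (y j) = if i = j then σ i else 0) ∧
      (∀ i j, g (z i) (z j) = if i = j then σ i else 0) ∧
      (∀ i j, g (y i) (z j) = 0) ∧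
      (∀ i j, ω (y i) (y j) = 0) ∧ (∀ i j, ω (z i) (z j) = 0) ∧
      (∀ i j, ω (y i) (z j) = if i = j then lam else 0) ∧
      (∀ i, 0 ≤ q (y i)) ∧ (∀ i, q (z i) = 0) := by
  let core : InnerProductSpace.Core ℝ V :=
    { inner := fun v w => g v w
      conj_inner_symm := fun v w => by simpa using hgs w v
      re_inner_nonneg := fun v => by
        by_cases h : v = 0
        · simp [h]
        · simpa using (hgp v h).le
      add_left := fun x y z => by simp
      smul_left := fun x y r => by simp
      definite := fun v h => by
        by_contra hv
        exact (hgp v hv).ne' h }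
  let _i : NormedAddCommGroup V := core.toNormedAddCommGroup
  let _i : InnerProductSpace ℝ V := InnerProductSpace.ofCore core.toCore
  have hin : ∀ v w : V, inner ℝ v w = g v w := fun v w => rfl
  have hnd : Function.Injective g := by
    rw [← LinearMap.ker_eq_bot, LinearMap.ker_eq_bot']
    intro v hv
    by_contra h
    have := hgp v h
    simp [hv] at this
  let ge : V ≃ₗ[ℝ] (V →ₗ[ℝ] ℝ) := LinearEquiv.ofInjectiveOfFinrankEq g hnd
    (by exact (Subspace.dual_finrank_eq (K := ℝ) (V := V)).symm)
  have hge : ∀ v, ge v = g v := fun v => rfl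
  let K : V →ₗ[ℝ] V := ge.symm.toLinearMap ∘ₗ ω
  have hK : ∀ v w, g (K v) w = ω v w := by
    intro v w
    rw [← hge]; simp [K]
  obtain ⟨b, c, μ, h1, h2, h3, h4, h5, h6, h7, h8⟩ := skew_normal m V K q
    (by
      intro v w
      rw [hin, hin, hK, hgs, hK, hω])
    (by
      intro v hv
      apply hωn
      intro w
      rw [← hK, hv]; simp) hdim
  simp only [hin] at h2 h3 h4
  let τ := Tuple.sort μ
  have hmono : Monotone (μ ∘ τ) := Tuple.monotone_sort μ
  set L := μ (τ ⟨m - 1, by omega⟩) with hL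
  have hL0 : 0 < L := h1 _
  have hle : ∀ i, μ (τ i) ≤ L := fun i => hmono (by
    rw [Fin.le_def]; have := i.2; simp; omega)
  have hsq : ∀ i, Real.sqrt (L / μ (τ i)) * Real.sqrt (L / μ (τ i)) = L / μ (τ i) :=
    fun i => Real.mul_self_sqrt (div_pos hL0 (h1 _)).le
  refine ⟨fun i => Real.sqrt (L / μ (τ i)) • b (τ i), fun i => Real.sqrt (L / μ (τ i)) • c (τ i),
    fun i => L / μ (τ i), L, hL0, ?_, ?_, ?_, ?_, ?_, ?_, ?_, ?_, ?_, ?_, ?_⟩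
  · intro i j hij
    exact div_le_div_of_nonneg_left hL0.le (h1 _) (hmono hij)
  · intro i
    rw [one_le_div (h1 _)]; exact hle i
  · exact div_self hL0.ne'
  · intro i j
    simp only [map_smul, LinearMap.smul_apply, smul_eq_mul, h2, τ.injective.eq_iff]
    split_ifs with h
    · subst h; rw [mul_one, hsq]
    · simp
  · intro i j
    simp only [map_smul, LinearMap.smul_apply, smul_eq_mul, h3, τ.injective.eq_iff]
    split_ifs with h
    · subst h; rw [mul_one, hsq]
    · simp
  · intro i j
    simp [h4]
  · intro i j
    simp [← hK, h5, hgs (c _) (b _), h4]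
  · intro i j
    simp [← hK, h6, h4]
  · intro i j
    simp only [map_smul, LinearMap.smul_apply, smul_eq_mul, ← hK, h5, h3, τ.injective.eq_iff]
    split_ifs with h
    · subst h
      have := h1 (τ i)
      rw [mul_one, mul_comm _ (μ _), mul_left_comm, hsq]
      field_simp
    · simp
  · intro i
    simp only [map_smul, smul_eq_mul]
    exact mul_nonneg (Real.sqrt_nonneg _) (h7 _)
  · intro i
    simp [h8]

section idx
variable {n : ℕ} (hn : 2 ≤ n)

def iX : Fin (2 * n) := ⟨0, by omega⟩
def iY (k : Fin (n - 1)) : Fin (2 * n) := ⟨k.val + 1, by omega⟩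
def iZ (k : Fin (n - 1)) : Fin (2 * n) := ⟨k.val + n, by omega⟩
def iW : Fin (2 * n) := ⟨2 * n - 1, by omega⟩

@[simp] lemma iX_val : (iX hn).val = 0 := rfl
@[simp] lemma iY_val (k) : (iY hn k).val = k.val + 1 := rfl
@[simp] lemma iZ_val (k) : (iZ hn k).val = k.val + n := rfl
@[simp] lemma iW_val : (iW hn).val = 2 * n - 1 := rfl

lemma idx_cases (i : Fin (2 * n)) :
    i = iX hn ∨ (∃ k, i = iY hn k) ∨ (∃ k, i = iZ hn k) ∨ i = iW hn := by
  have hi := i.2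
  by_cases h0 : i.val = 0
  · left; exact Fin.ext h0
  by_cases h1 : i.val ≤ n - 1
  · right; left; exact ⟨⟨i.val - 1, by omega⟩, Fin.ext (by simp; omega)⟩
  by_cases h2 : i.val ≤ 2 * n - 2
  · right; right; left; exact ⟨⟨i.val - n, by omega⟩, Fin.ext (by simp; omega)⟩
  · right; right; right; exact Fin.ext (by simp; omega)

@[simp] lemma iXY (k) : iX hn = iY hn k ↔ False := by simp [Fin.ext_iff]
@[simp] lemma iYX (k) : iY hn k = iX hn ↔ False := by simp [Fin.ext_iff]
@[simp] lemma iXZ (k) : iX hn = iZ hn k ↔ False := by simp [Fin.ext_iff]; omega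
@[simp] lemma iZX (k) : iZ hn k = iX hn ↔ False := by simp [Fin.ext_iff]; omega
@[simp] lemma iXW : iX hn = iW hn ↔ False := by simp [Fin.ext_iff]; omega
@[simp] lemma iWX : iW hn = iX hn ↔ False := by simp [Fin.ext_iff]; omega
@[simp] lemma iYZ (k l) : iY hn k = iZ hn l ↔ False := by simp [Fin.ext_iff]; omega
@[simp] lemma iZY (k l) : iZ hn k = iY hn l ↔ False := by simp [Fin.ext_iff]; omega
@[simp] lemma iYW (k) : iY hn k = iW hn ↔ False := by simp [Fin.ext_iff]; omega
@[simp] lemma iWY (k) : iW hn = iY hn k ↔ False := by simp [Fin.ext_iff]; omega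
@[simp] lemma iZW (k) : iZ hn k = iW hn ↔ False := by simp [Fin.ext_iff]; omega
@[simp] lemma iWZ (k) : iW hn = iZ hn k ↔ False := by simp [Fin.ext_iff]; omega
@[simp] lemma iYY (k l) : iY hn k = iY hn l ↔ k = l := by simp [Fin.ext_iff]
@[simp] lemma iZZ (k l) : iZ hn k = iZ hn l ↔ k = l := by simp [Fin.ext_iff]

lemma sum_idx {M : Type*} [AddCommMonoid M] (f : Fin (2 * n) → M) :
    ∑ i, f i = f (iX hn) + (∑ k, f (iY hn k)) + (∑ k, f (iZ hn k)) + f (iW hn) := by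
  let e : (Unit ⊕ Fin (n - 1)) ⊕ (Fin (n - 1) ⊕ Unit) → Fin (2 * n) :=
    Sum.elim (Sum.elim (fun _ => iX hn) (iY hn)) (Sum.elim (iZ hn) (fun _ => iW hn))
  have he : Function.Bijective e := by
    constructor
    · rintro ((a | a) | (a | a)) ((b | b) | (b | b)) h <;> simp [e] at h ⊢ <;> exact h
    · intro i
      rcases idx_cases hn i with h | ⟨k, h⟩ | ⟨k, h⟩ | h
      · exact ⟨Sum.inl (Sum.inl ()), h.symm⟩
      · exact ⟨Sum.inl (Sum.inr k), h.symm⟩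
      · exact ⟨Sum.inr (Sum.inl k), h.symm⟩
      · exact ⟨Sum.inr (Sum.inr ()), h.symm⟩
  rw [← Fintype.sum_bijective e he (fun a => f (e a)) f (fun _ => rfl)]
  simp [e, add_assoc]

def mk {α : Type*} (t : α) (y z : Fin (n - 1) → α) (s : α) : Fin (2 * n) → α := fun i =>
  if i.val = 0 then t else if h : 1 ≤ i.val ∧ i.val ≤ n - 1 then y ⟨i.val - 1, by omega⟩
  else if h : n ≤ i.val ∧ i.val ≤ 2 * n - 2 then z ⟨i.val - n, by omega⟩ else s

variable {α : Type*} (t : α) (y z : Fin (n - 1) → α) (s : α)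

@[simp] lemma mk_X : mk hn t y z s (iX hn) = t := by simp [mk]
@[simp] lemma mk_Y (k) : mk hn t y z s (iY hn k) = y k := by
  have h : k.val + 1 ≤ n - 1 := by omega
  simp [mk, h]
@[simp] lemma mk_Z (k) : mk hn t y z s (iZ hn k) = z k := by
  have := k.2
  have h1 : ¬ (k.val + n = 0) := by omega
  have h2 : ¬ (1 ≤ k.val + n ∧ k.val + n ≤ n - 1) := by omega
  have h3 : (n ≤ k.val + n ∧ k.val + n ≤ 2 * n - 2) := by omega
  simp only [mk, iZ_val, dif_neg h2, if_neg h1, dif_pos h3, Nat.add_sub_cancel]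
@[simp] lemma mk_W : mk hn t y z s (iW hn) = s := by
  have h1 : ¬ (2 * n - 1 = 0) := by omega
  have h2 : ¬ (1 ≤ 2 * n - 1 ∧ 2 * n - 1 ≤ n - 1) := by omega
  have h3 : ¬ (n ≤ 2 * n - 1 ∧ 2 * n - 1 ≤ 2 * n - 2) := by omega
  unfold mk
  rw [if_neg (show ¬ (iW hn).val = 0 from h1), dif_neg (show ¬ (1 ≤ (iW hn).val ∧ (iW hn).val ≤ n - 1) from h2),
    dif_neg (show ¬ (n ≤ (iW hn).val ∧ (iW hn).val ≤ 2 * n - 2) from h3)]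

lemma idx_ext {f g : Fin (2 * n) → α} (hX : f (iX hn) = g (iX hn))
    (hY : ∀ k, f (iY hn k) = g (iY hn k)) (hZ : ∀ k, f (iZ hn k) = g (iZ hn k))
    (hW : f (iW hn) = g (iW hn)) : f = g := by
  ext i
  rcases idx_cases hn i with h | ⟨k, h⟩ | ⟨k, h⟩ | h <;> subst h <;> simp [*]

lemma ite_zero_of {P : Prop} [Decidable P] {a : ℝ} (h : ¬ P) : (if P then a else 0) = 0 := if_neg h

lemma structC_X (i j : Fin (2 * n)) : structC n i j (iX hn) = 0 := by
  unfold structC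
  have e1 : ¬ (i.val = 0 ∧ j = iX hn ∧ 1 ≤ j.val ∧ j.val ≤ 2 * n - 2) := by
    simp only [Fin.ext_iff, iX_val]; omega
  have e2 : ¬ (j.val = 0 ∧ i = iX hn ∧ 1 ≤ i.val ∧ i.val ≤ 2 * n - 2) := by
    simp only [Fin.ext_iff, iX_val]; omega
  have e3 : ¬ (0 = 2 * n - 1) := by omega
  rw [if_neg e1, if_neg e2]
  simp [e3]

lemma structC_Y (i j : Fin (2 * n)) (k) : structC n i j (iY hn k) =
    (if i = iX hn ∧ j = iY hn k then 1 / 2 else 0) -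
    (if j = iX hn ∧ i = iY hn k then 1 / 2 else 0) := by
  unfold structC
  have e1 : (i.val = 0 ∧ j = iY hn k ∧ 1 ≤ j.val ∧ j.val ≤ 2 * n - 2) ↔
      (i = iX hn ∧ j = iY hn k) := by
    simp only [Fin.ext_iff, iX_val, iY_val]; omega
  have e2 : (j.val = 0 ∧ i = iY hn k ∧ 1 ≤ i.val ∧ i.val ≤ 2 * n - 2) ↔
      (j = iX hn ∧ i = iY hn k) := by
    simp only [Fin.ext_iff, iX_val, iY_val]; omega
  have e3 : ¬ (k.val + 1 = 2 * n - 1) := by omega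
  simp only [e1, e2, iY_val, e3, and_false, if_false]
  ring

lemma structC_Z (i j : Fin (2 * n)) (k) : structC n i j (iZ hn k) =
    (if i = iX hn ∧ j = iZ hn k then 1 / 2 else 0) -
    (if j = iX hn ∧ i = iZ hn k then 1 / 2 else 0) := by
  unfold structC
  have e1 : (i.val = 0 ∧ j = iZ hn k ∧ 1 ≤ j.val ∧ j.val ≤ 2 * n - 2) ↔
      (i = iX hn ∧ j = iZ hn k) := by
    simp only [Fin.ext_iff, iX_val, iZ_val]; omega
  have e2 : (j.val = 0 ∧ i = iZ hn k ∧ 1 ≤ i.val ∧ i.val ≤ 2 * n - 2) ↔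
      (j = iX hn ∧ i = iZ hn k) := by
    simp only [Fin.ext_iff, iX_val, iZ_val]; omega
  have e3 : ¬ (k.val + n = 2 * n - 1) := by omega
  simp only [e1, e2, iZ_val, e3, and_false, if_false]
  ring

lemma sum_pair (i j : Fin (2 * n)) :
    (if n ≤ i.val ∧ i.val ≤ 2 * n - 2 ∧ i.val = j.val + (n - 1) then (1 : ℝ) else 0) =
    ∑ k, if i = iZ hn k ∧ j = iY hn k then (1 : ℝ) else 0 := by
  split_ifs with h
  · rw [Finset.sum_eq_single (⟨i.val - n, by omega⟩ : Fin (n - 1))]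
    · rw [if_pos]
      simp only [Fin.ext_iff, iZ_val, iY_val]; omega
    · intro b _ hb
      rw [if_neg]
      rintro ⟨rfl, -⟩
      apply hb
      ext; simp
    · simp
  · symm
    apply Finset.sum_eq_zero
    intro k _
    rw [if_neg]
    rintro ⟨rfl, rfl⟩
    apply h
    simp; omega

lemma structC_W (i j : Fin (2 * n)) : structC n i j (iW hn) =
    (if i = iX hn ∧ j = iW hn then 1 else 0) -
    (if j = iX hn ∧ i = iW hn then 1 else 0) +
    (∑ k, if i = iZ hn k ∧ j = iY hn k then (1 : ℝ) else 0) -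
    (∑ k, if j = iZ hn k ∧ i = iY hn k then (1 : ℝ) else 0) := by
  unfold structC
  have e1 : ¬ (i.val = 0 ∧ j = iW hn ∧ 1 ≤ j.val ∧ j.val ≤ 2 * n - 2) := by
    simp only [Fin.ext_iff, iW_val]; omega
  have e2 : ¬ (j.val = 0 ∧ i = iW hn ∧ 1 ≤ i.val ∧ i.val ≤ 2 * n - 2) := by
    simp only [Fin.ext_iff, iW_val]; omega
  rw [if_neg e1, if_neg e2, ← sum_pair hn, ← sum_pair hn]
  simp only [iW_val, and_true, Fin.ext_iff, iX_val, sub_zero, zero_add]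

lemma sum_delta (u v : Fin (2 * n) → ℝ) (a b : Fin (2 * n)) (c : ℝ) :
    ∑ i, ∑ j, u i * v j * (if i = a ∧ j = b then c else 0) = u a * v b * c := by
  simp [ite_and]

lemma sum_delta2 (u v : Fin (2 * n) → ℝ) (a b : Fin (2 * n)) (c : ℝ) :
    ∑ i, ∑ j, u i * v j * (if j = a ∧ i = b then c else 0) = u b * v a * c := by
  simp [ite_and]

lemma bracket_X (u v : Fin (2 * n) → ℝ) : bracket n u v (iX hn) = 0 := by
  simp [bracket, structC_X]

lemma bracket_Y (u v : Fin (2 * n) → ℝ) (k) : bracket n u v (iY hn k) =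
    (u (iX hn) * v (iY hn k) - v (iX hn) * u (iY hn k)) / 2 := by
  simp only [bracket, structC_Y, mul_sub, Finset.sum_sub_distrib, sum_delta, sum_delta2]
  ring

lemma bracket_Z (u v : Fin (2 * n) → ℝ) (k) : bracket n u v (iZ hn k) =
    (u (iX hn) * v (iZ hn k) - v (iX hn) * u (iZ hn k)) / 2 := by
  simp only [bracket, structC_Z, mul_sub, Finset.sum_sub_distrib, sum_delta, sum_delta2]
  ring

lemma sum3 (u v : Fin (2 * n) → ℝ) (f : Fin (2 * n) → Fin (2 * n) → Fin (n - 1) → ℝ) :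
    ∑ i, ∑ j, u i * v j * ∑ k, f i j k = ∑ k, ∑ i, ∑ j, u i * v j * f i j k := by
  simp only [Finset.mul_sum]
  rw [Finset.sum_comm (s := (Finset.univ : Finset (Fin (n - 1))))]
  refine Finset.sum_congr rfl fun i _ => ?_
  exact Finset.sum_comm

lemma bracket_W (u v : Fin (2 * n) → ℝ) : bracket n u v (iW hn) =
    u (iX hn) * v (iW hn) - v (iX hn) * u (iW hn) +
    ∑ k, (u (iZ hn k) * v (iY hn k) - v (iZ hn k) * u (iY hn k)) := by
  simp only [bracket, structC_W, mul_sub, mul_add, Finset.sum_sub_distrib, Finset.sum_add_distrib,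
    sum_delta, sum_delta2, sum3, mul_one]
  simp only [mul_comm]
  ring

lemma isAut_of_cols (col : Fin (2 * n) → Fin (2 * n) → ℝ)
    (h : ∀ i j, ∑ k, structC n i j k • col k = bracket n (col i) (col j))
    (u v : Fin (2 * n) → ℝ) :
    (Matrix.of fun i j => col j i).mulVec (bracket n u v) =
      bracket n ((Matrix.of fun i j => col j i).mulVec u) ((Matrix.of fun i j => col j i).mulVec v) := by
  let bl : (Fin (2 * n) → ℝ) →ₗ[ℝ] (Fin (2 * n) → ℝ) →ₗ[ℝ] (Fin (2 * n) → ℝ) :=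
    LinearMap.mk₂ ℝ (bracket n)
      (by intros; ext; simp [bracket, add_mul, Finset.sum_add_distrib])
      (by intros; ext; simp [bracket, Finset.mul_sum, mul_assoc])
      (by intros; ext; simp [bracket, mul_add, add_mul, Finset.sum_add_distrib])
      (by intros; ext; simp [bracket, Finset.mul_sum, mul_assoc, mul_left_comm])
  have hbl : ∀ u v, bracket n u v = bl u v := fun _ _ => rfl
  have hF : ∀ w : Fin (2 * n) → ℝ, (Matrix.of fun i j => col j i).mulVec w = ∑ k, w k • col k := by
    intro w; ext i; simp [Matrix.mulVec, dotProduct, mul_comm]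
  rw [hF, hF, hF, hbl (∑ k, u k • col k)]
  simp only [map_sum, LinearMap.sum_apply, map_smul, LinearMap.smul_apply, ← hbl, ← h]
  simp only [bracket, Finset.sum_smul, Finset.smul_sum, smul_smul]
  rw [Finset.sum_comm]
  conv_rhs => rw [Finset.sum_comm]
  refine Finset.sum_congr rfl fun i _ => ?_
  rw [Finset.sum_comm]
  refine Finset.sum_congr rfl fun j _ => Finset.sum_congr rfl fun k _ => ?_
  congr 1
  ring
end idx

section sform
variable {n : ℕ} (hn : 2 ≤ n) (p β : ℝ) (x σ : Fin (n - 1) → ℝ)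

lemma Sform_XX : Sform n p x σ β (iX hn) (iX hn) = p := by simp [Sform]
lemma Sform_XY (k) : Sform n p x σ β (iX hn) (iY hn k) = x k := by
  have h : k.val + 1 ≤ n - 1 := by omega
  simp [Sform, h]
lemma Sform_XZ (k) : Sform n p x σ β (iX hn) (iZ hn k) = 0 := by
  have h : ¬ k.val + n ≤ n - 1 := by omega
  have h' : ¬ (k.val = 0 ∧ n = 0) := by omega
  simp [Sform, h, h']
lemma Sform_XW : Sform n p x σ β (iX hn) (iW hn) = 0 := by
  have h : ¬ 2 * n - 1 ≤ n - 1 := by omega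
  have h' : ¬ (2 * n - 1 = 0) := by omega
  simp [Sform, h, h']
lemma Sform_YX (k) : Sform n p x σ β (iY hn k) (iX hn) = x k := by
  have h : k.val + 1 ≤ n - 1 := by omega
  simp [Sform, h]
lemma Sform_ZX (k) : Sform n p x σ β (iZ hn k) (iX hn) = 0 := by
  have h : ¬ k.val + n ≤ n - 1 := by omega
  have h' : ¬ (k.val = 0 ∧ n = 0) := by omega
  simp [Sform, h, h']
lemma Sform_WX : Sform n p x σ β (iW hn) (iX hn) = 0 := by
  have h : ¬ 2 * n - 1 ≤ n - 1 := by omega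
  have h' : ¬ (2 * n - 1 = 0) := by omega
  simp [Sform, h, h']
lemma Sform_YY (k l) : Sform n p x σ β (iY hn k) (iY hn l) = if k = l then σ k else 0 := by
  have h : k.val + 1 ≤ n - 1 := by omega
  have h' : ¬ n ≤ k.val + 1 := by omega
  have h'' : ¬ k.val + 1 = 2 * n - 1 := by omega
  simp [Sform, h, h', h'']
lemma Sform_ZZ (k l) : Sform n p x σ β (iZ hn k) (iZ hn l) = if k = l then σ k else 0 := by
  have h0 : ¬ (k.val = 0 ∧ n = 0) := by omega
  have h1 : ¬ (l.val = 0 ∧ n = 0) := by omega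
  have h : ¬ k.val + n ≤ n - 1 := by omega
  have h' : k.val + n ≤ 2 * n - 2 := by omega
  have h'' : ¬ k.val + n = 2 * n - 1 := by omega
  simp [Sform, h, h', h'', h0, h1]
lemma Sform_WW : Sform n p x σ β (iW hn) (iW hn) = β := by
  have h0 : ¬ (2 * n - 1 = 0) := by omega
  have h : ¬ 2 * n - 1 ≤ n - 1 := by omega
  have h' : ¬ 2 * n - 1 ≤ 2 * n - 2 := by omega
  simp [Sform, h, h', h0]
lemma Sform_YZ (k l) : Sform n p x σ β (iY hn k) (iZ hn l) = 0 := by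
  have h1 : ¬ (l.val = 0 ∧ n = 0) := by omega
  simp [Sform, h1]
lemma Sform_ZY (k l) : Sform n p x σ β (iZ hn l) (iY hn k) = 0 := by
  have h1 : ¬ (l.val = 0 ∧ n = 0) := by omega
  simp [Sform, h1]
lemma Sform_YW (k) : Sform n p x σ β (iY hn k) (iW hn) = 0 := by
  have h0 : ¬ (2 * n - 1 = 0) := by omega
  simp [Sform, h0]
lemma Sform_WY (k) : Sform n p x σ β (iW hn) (iY hn k) = 0 := by
  have h0 : ¬ (2 * n - 1 = 0) := by omega
  simp [Sform, h0]
lemma Sform_ZW (k) : Sform n p x σ β (iZ hn k) (iW hn) = 0 := by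
  have h0 : ¬ (2 * n - 1 = 0) := by omega
  have h1 : ¬ (k.val = 0 ∧ n = 0) := by omega
  simp [Sform, h0, h1]
lemma Sform_WZ (k) : Sform n p x σ β (iW hn) (iZ hn k) = 0 := by
  have h0 : ¬ (2 * n - 1 = 0) := by omega
  have h1 : ¬ (k.val = 0 ∧ n = 0) := by omega
  simp [Sform, h0, h1]
end sform

section main

abbrev VV (n : ℕ) : Type := (Fin (n - 1) → ℝ) × (Fin (n - 1) → ℝ)

variable {n : ℕ} (hn : 2 ≤ n)

/-- Assembling: adapted columns give the automorphism and the normal form. -/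
lemma assemble (S : Matrix (Fin (2 * n)) (Fin (2 * n)) ℝ)
    (B : (Fin (2 * n) → ℝ) →ₗ[ℝ] (Fin (2 * n) → ℝ) →ₗ[ℝ] ℝ)
    (hB : ∀ u v, B u v = u ⬝ᵥ S.mulVec v) (hBs : ∀ u v, B u v = B v u)
    (X' W' : Fin (2 * n) → ℝ) (vY vZ : Fin (n - 1) → Fin (2 * n) → ℝ)
    (p β : ℝ) (x σ : Fin (n - 1) → ℝ) (hβ : β ≠ 0) (hσ : ∀ i, σ i ≠ 0)
    (hX0 : X' (iX hn) = 1) (hW0 : W' (iX hn) = 0)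
    (hY0 : ∀ k, vY k (iX hn) = 0) (hZ0 : ∀ k, vZ k (iX hn) = 0)
    (hXX : B X' X' = p) (hXY : ∀ k, B X' (vY k) = x k) (hXZ : ∀ k, B X' (vZ k) = 0)
    (hXW : B X' W' = 0) (hYY : ∀ k l, B (vY k) (vY l) = if k = l then σ k else 0)
    (hZZ : ∀ k l, B (vZ k) (vZ l) = if k = l then σ k else 0)
    (hYZ : ∀ k l, B (vY k) (vZ l) = 0) (hYW : ∀ k, B (vY k) W' = 0) (hZW : ∀ k, B (vZ k) W' = 0)
    (hWW : B W' W' = β)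
    (bXY : ∀ k, bracket n X' (vY k) = (1 / 2 : ℝ) • vY k)
    (bXZ : ∀ k, bracket n X' (vZ k) = (1 / 2 : ℝ) • vZ k)
    (bXW : bracket n X' W' = W')
    (bZY : ∀ k l, bracket n (vZ k) (vY l) = if k = l then W' else 0)
    (bYY : ∀ k l, bracket n (vY k) (vY l) = 0)
    (bZZ : ∀ k l, bracket n (vZ k) (vZ l) = 0)
    (bYW : ∀ k, bracket n (vY k) W' = 0)
    (bZW : ∀ k, bracket n (vZ k) W' = 0) :
    ∃ F, IsAut n F ∧ F.transpose * S * F = Sform n p x σ β := by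
  have hanti : ∀ u v, bracket n u v = - bracket n v u := by
    intro u v
    apply idx_ext hn
    · simp [bracket_X]
    · intro k; simp only [bracket_Y, Pi.neg_apply]; ring
    · intro k; simp only [bracket_Z, Pi.neg_apply]; ring
    · simp only [bracket_W, Pi.neg_apply, Finset.sum_sub_distrib]; ring
  have hself : ∀ u, bracket n u u = 0 := by
    intro u
    apply idx_ext hn
    · simp [bracket_X]
    · intro k; simp [bracket_Y]
    · intro k; simp [bracket_Z]
    · simp [bracket_W]
  have bYX := fun k => (hanti (vY k) X').trans (congrArg Neg.neg (bXY k))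
  have bZX := fun k => (hanti (vZ k) X').trans (congrArg Neg.neg (bXZ k))
  have bWX := (hanti W' X').trans (congrArg Neg.neg bXW)
  have bYZ := fun k l => (hanti (vY l) (vZ k)).trans (congrArg Neg.neg (bZY k l))
  have bWY := fun k => (hanti W' (vY k)).trans (congrArg Neg.neg (bYW k))
  have bWZ := fun k => (hanti W' (vZ k)).trans (congrArg Neg.neg (bZW k))
  let col : Fin (2 * n) → Fin (2 * n) → ℝ := mk hn X' vY vZ W'
  have cX : col (iX hn) = X' := mk_X ..
  have cY : ∀ k, col (iY hn k) = vY k := fun k => mk_Y ..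
  have cZ : ∀ k, col (iZ hn k) = vZ k := fun k => mk_Z ..
  have cW : col (iW hn) = W' := mk_W ..
  have hcol := isAut_of_cols col (by
    intro i j
    rw [sum_idx hn]
    simp only [structC_X, structC_Y, structC_Z, structC_W, cX, cY, cZ, cW]
    rcases idx_cases hn i with h | ⟨k, h⟩ | ⟨k, h⟩ | h <;> subst h <;>
    rcases idx_cases hn j with h | ⟨l, h⟩ | ⟨l, h⟩ | h <;> subst h <;>
    simp [cX, cY, cZ, cW, bXY, bXZ, bXW, bZY, bYY, bZZ, bYW, bZW, bYX, bZX, bWX, bYZ, bWY, bWZ,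
      hself, ite_and, ite_smul] <;> exact if_congr eq_comm rfl rfl)
  set F : Matrix (Fin (2 * n)) (Fin (2 * n)) ℝ := Matrix.of fun i j => col j i with hF
  have hform : F.transpose * S * F = Sform n p x σ β := by
    ext i j
    have : (F.transpose * S * F) i j = B (col i) (col j) := by
      rw [hB, Matrix.mul_assoc, Matrix.mul_apply']
      rfl
    rw [this]
    rcases idx_cases hn i with h | ⟨k, h⟩ | ⟨k, h⟩ | h <;> subst h <;>
    rcases idx_cases hn j with h | ⟨l, h⟩ | ⟨l, h⟩ | h <;> subst h <;>
    simp only [cX, cY, cZ, cW, Sform_XX, Sform_XY, Sform_XZ, Sform_XW, Sform_YX, Sform_YY,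
      Sform_YZ, Sform_YW, Sform_ZX, Sform_ZY, Sform_ZZ, Sform_ZW, Sform_WX, Sform_WY, Sform_WZ,
      Sform_WW, hXX, hXY, hXZ, hXW, hYY, hYZ, hYW, hZZ, hZW, hWW, hBs (vY _) X', hBs (vZ _) X',
      hBs W' X', hBs (vZ _) (vY _), hBs W' (vY _), hBs W' (vZ _)]
  refine ⟨F, ⟨?_, hcol⟩, hform⟩
  rw [← Matrix.mulVec_injective_iff_isUnit]
  rw [← Matrix.coe_mulVecLin, ← LinearMap.ker_eq_bot, LinearMap.ker_eq_bot']
  intro w hw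
  rw [Matrix.mulVecLin_apply] at hw
  have hSw : (Sform n p x σ β).mulVec w = 0 := by
    rw [← hform, ← Matrix.mulVec_mulVec, hw, Matrix.mulVec_zero]
  have hwX : w (iX hn) = 0 := by
    have := congrFun hw (iX hn)
    simpa [Matrix.mulVec, dotProduct, sum_idx hn, hF, cX, cY, cZ, cW, hX0, hY0, hZ0, hW0] using this
  apply idx_ext hn
  · simp [hwX]
  · intro k
    have := congrFun hSw (iY hn k)
    simpa [Matrix.mulVec, dotProduct, sum_idx hn, Sform_YX, Sform_YY, Sform_YZ, Sform_YW, hwX, hσ] using this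
  · intro k
    have := congrFun hSw (iZ hn k)
    simpa [Matrix.mulVec, dotProduct, sum_idx hn, Sform_ZX, Sform_ZY, Sform_ZZ, Sform_ZW, hwX, hσ] using this
  · have := congrFun hSw (iW hn)
    simpa [Matrix.mulVec, dotProduct, sum_idx hn, Sform_WX, Sform_WY, Sform_WZ, Sform_WW, hwX, hβ] using this

end main

theorem classification_existence (n : ℕ) (hn : 2 ≤ n)
    (S : Matrix (Fin (2 * n)) (Fin (2 * n)) ℝ) (hS : S.PosDef) :
    ∃ (F : Matrix (Fin (2 * n)) (Fin (2 * n)) ℝ) (p β : ℝ) (x σ : Fin (n - 1) → ℝ),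
      IsAut n F ∧ Admissible n p x σ β ∧
        F.transpose * S * F = Sform n p x σ β := by
  let B : (Fin (2 * n) → ℝ) →ₗ[ℝ] (Fin (2 * n) → ℝ) →ₗ[ℝ] ℝ := Matrix.toLinearMap₂' ℝ S
  have hB : ∀ u v, B u v = u ⬝ᵥ S.mulVec v := fun u v => Matrix.toLinearMap₂'_apply' S u v
  have hBp : ∀ u, u ≠ 0 → 0 < B u u := by
    intro u hu
    rw [hB]
    simpa using hS.dotProduct_mulVec_pos hu
  have hBs : ∀ u v, B u v = B v u := by
    intro u v
    have hT : S.transpose = S := by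
      have := hS.1
      rwa [Matrix.IsHermitian, Matrix.conjTranspose_eq_transpose_of_trivial] at this
    rw [hB, hB, Matrix.dotProduct_mulVec, ← Matrix.mulVec_transpose, hT, dotProduct_comm]
  let eW : Fin (2 * n) → ℝ := mk hn 0 0 0 1
  have heWW : eW (iW hn) = 1 := mk_W ..
  have heWX : eW (iX hn) = 0 := mk_X ..
  have heWY : ∀ k, eW (iY hn k) = 0 := fun k => mk_Y ..
  have heWZ : ∀ k, eW (iZ hn k) = 0 := fun k => mk_Z ..
  have heW : eW ≠ 0 := fun h => by simp [h] at heWW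
  have hβ0 := hBp eW heW
  set β0 := B eW eW with hβ0'
  let L0 : VV n →ₗ[ℝ] (Fin (2 * n) → ℝ) :=
    { toFun := fun v => mk hn 0 v.1 v.2 0
      map_add' := fun a b => idx_ext hn (by simp) (by simp) (by simp) (by simp)
      map_smul' := fun r a => idx_ext hn (by simp) (by simp) (by simp) (by simp) }
  have hL0 : ∀ v, L0 v = mk hn 0 v.1 v.2 0 := fun v => rfl
  let ell : VV n →ₗ[ℝ] ℝ := (-β0⁻¹) • (B.flip eW ∘ₗ L0)
  have hell : ∀ v, ell v = - β0⁻¹ * B (L0 v) eW := fun v => rfl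
  let L : VV n →ₗ[ℝ] (Fin (2 * n) → ℝ) := L0 + ell.smulRight eW
  have hL : ∀ v, L v = L0 v + ell v • eW := fun v => rfl
  have hLX : ∀ v, L v (iX hn) = 0 := fun v => by simp [hL, hL0, heWX]
  have hLY : ∀ v k, L v (iY hn k) = v.1 k := fun v k => by simp [hL, hL0, heWY]
  have hLZ : ∀ v k, L v (iZ hn k) = v.2 k := fun v k => by simp [hL, hL0, heWZ]
  have hLW : ∀ v, L v (iW hn) = ell v := fun v => by simp [hL, hL0, heWW]
  have hBLW : ∀ v, B (L v) eW = 0 := by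
    intro v
    rw [hL, map_add, map_smul, LinearMap.add_apply, LinearMap.smul_apply, hell, smul_eq_mul]
    rw [← hβ0']
    field_simp
    ring
  have hLinj : ∀ v, v ≠ 0 → L v ≠ 0 := by
    intro v hv h
    apply hv
    ext k
    · rw [← hLY, h]; rfl
    · rw [← hLZ, h]; rfl
  let u : VV n := (fun k => (1 / 2) * ell (0, Pi.single k 1), fun k => -(1 / 2) * ell (Pi.single k 1, 0))
  have hu : ∀ v : VV n, ∑ k, (u.2 k * v.1 k - v.2 k * u.1 k) = - (1 / 2) * ell v := by
    intro v
    have h1 : ell v = ∑ k, v.1 k * ell (Pi.single k 1, 0) + ∑ k, v.2 k * ell (0, Pi.single k 1) := by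
      have e : v = LinearMap.inl ℝ _ _ v.1 + LinearMap.inr ℝ _ _ v.2 := by ext <;> simp
      have a1 := LinearMap.pi_apply_eq_sum_univ (ell ∘ₗ LinearMap.inl ℝ _ _) v.1
      have a2 := LinearMap.pi_apply_eq_sum_univ (ell ∘ₗ LinearMap.inr ℝ _ _) v.2
      have hs : ∀ k : Fin (n - 1), (fun j => if k = j then (1 : ℝ) else 0) = Pi.single k 1 := by
        intro k; ext j; simp [Pi.single_apply, eq_comm]
      conv_lhs => rw [e, map_add]
      simp only [LinearMap.comp_apply, hs] at a1 a2
      rw [a1, a2]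
      rfl
    rw [h1, mul_add, Finset.mul_sum, Finset.mul_sum, ← Finset.sum_add_distrib]
    refine Finset.sum_congr rfl fun k _ => ?_
    simp only [u]
    ring
  let X0 : Fin (2 * n) → ℝ := mk hn 1 u.1 u.2 0
  let a : ℝ := - β0⁻¹ * B X0 eW
  let X' : Fin (2 * n) → ℝ := X0 + a • eW
  have hXX : X' (iX hn) = 1 := by simp [X', X0, heWX]
  have hXY : ∀ k, X' (iY hn k) = u.1 k := fun k => by simp [X', X0, heWY]
  have hXZ : ∀ k, X' (iZ hn k) = u.2 k := fun k => by simp [X', X0, heWZ]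
  have hBX : B X' eW = 0 := by
    simp only [X', a]
    rw [map_add, map_smul, LinearMap.add_apply, LinearMap.smul_apply, smul_eq_mul, ← hβ0']
    field_simp
    ring
  have hX'0 : X' ≠ 0 := fun h => by simp [h] at hXX
  let om : VV n →ₗ[ℝ] VV n →ₗ[ℝ] ℝ := LinearMap.mk₂ ℝ (fun v w => ∑ k, (v.1 k * w.2 k - v.2 k * w.1 k))
    (by intro a b c; rw [← Finset.sum_add_distrib]
        refine Finset.sum_congr rfl fun k _ => ?_
        simp; ring)
    (by intro r b c; rw [smul_eq_mul, Finset.mul_sum]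
        refine Finset.sum_congr rfl fun k _ => ?_
        simp; ring)
    (by intro a b c; rw [← Finset.sum_add_distrib]
        refine Finset.sum_congr rfl fun k _ => ?_
        simp; ring)
    (by intro r b c; rw [smul_eq_mul, Finset.mul_sum]
        refine Finset.sum_congr rfl fun k _ => ?_
        simp; ring)
  have hom : ∀ v w, om v w = ∑ k, (v.1 k * w.2 k - v.2 k * w.1 k) := fun v w => rfl
  obtain ⟨y, z, σ, lam, hlam, hanti, hσ1, hσl, gyy, gzz, gyz, oyy, ozz, oyz, qy, qz⟩ :=
    williamson (n - 1) (by omega) (VV n) (by simp [VV]; ring) (B.compl₁₂ L L) om (B X' ∘ₗ L)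
      (fun v w => hBs _ _) (fun v hv => hBp _ (hLinj v hv))
      (by
        intro v w
        rw [hom, hom, ← Finset.sum_neg_distrib]
        refine Finset.sum_congr rfl fun k _ => ?_
        ring)
      (by
        intro v hv
        ext k
        · have := hv (0, Pi.single k 1)
          simpa [hom, Pi.single_apply] using this
        · have := hv (Pi.single k 1, 0)
          simpa [hom, Pi.single_apply] using this)
  simp only [LinearMap.compl₁₂_apply] at gyy gzz gyz
  simp only [LinearMap.comp_apply] at qy qz
  have brXL : ∀ v, bracket n X' (L v) = (1 / 2 : ℝ) • L v := by
    intro v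
    apply idx_ext hn
    · simp [bracket_X, hLX]
    · intro k; simp [bracket_Y, hLX, hLY, hXX]; ring
    · intro k; simp [bracket_Z, hLX, hLZ, hXX]; ring
    · simp only [bracket_W, hLX, hLY, hLZ, hXX, hXY, hXZ, hu, hLW, Pi.smul_apply, smul_eq_mul]; ring
  have brLL : ∀ v w, bracket n (L v) (L w) = om w v • eW := by
    intro v w
    apply idx_ext hn
    · simp [bracket_X, heWX]
    · intro k; simp [bracket_Y, hLX, heWY]
    · intro k; simp [bracket_Z, hLX, heWZ]
    · simp only [bracket_W, hLX, hLY, hLZ, heWW, hom, Pi.smul_apply, smul_eq_mul, zero_mul, sub_zero,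
        zero_add, mul_one]
      refine Finset.sum_congr rfl fun k _ => ?_
      ring
  have brXW : bracket n X' (lam • eW) = lam • eW := by
    apply idx_ext hn
    · simp [bracket_X, heWX]
    · intro k; simp [bracket_Y, heWX, heWY]
    · intro k; simp [bracket_Z, heWX, heWZ]
    · simp [bracket_W, hXX, heWX, heWY, heWZ]
  have brLW : ∀ v, bracket n (L v) (lam • eW) = 0 := by
    intro v
    apply idx_ext hn
    · simp [bracket_X]
    · intro k; simp [bracket_Y, heWX, heWY]
    · intro k; simp [bracket_Z, heWX, heWZ]
    · simp [bracket_W, hLX, heWX, heWY, heWZ]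
  have hσ0 : ∀ i, σ i ≠ 0 := fun i => (lt_of_lt_of_le one_pos (hσ1 i)).ne'
  have hβp : 0 < lam * (lam * β0) := by positivity
  obtain ⟨F, hF1, hF2⟩ := assemble hn S B hB hBs X' (lam • eW) (fun k => L (y k)) (fun k => L (z k))
    (B X' X') (lam * (lam * β0)) (fun k => B X' (L (y k))) σ hβp.ne' hσ0
    hXX (by simp [heWX]) (fun k => hLX _) (fun k => hLX _) rfl (fun k => rfl) qz
    (by rw [map_smul, hBX, smul_zero]) gyy gzz gyz (fun k => by rw [map_smul, hBLW, smul_zero])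
    (fun k => by rw [map_smul, hBLW, smul_zero])
    (by rw [map_smul, map_smul, LinearMap.smul_apply]; rfl)
    (fun k => brXL _) (fun k => brXL _) brXW
    (fun k l => by
      rw [brLL, oyz]
      by_cases h : k = l
      · simp [h]
      · simp [h, Ne.symm h])
    (fun k l => by rw [brLL, oyy, zero_smul]) (fun k l => by rw [brLL, ozz, zero_smul])
    (fun k => brLW _) (fun k => brLW _)
  refine ⟨F, B X' X', lam * (lam * β0), fun k => B X' (L (y k)), σ, hF1, ?_, hF2⟩
  exact ⟨hBp _ hX'0, hβp, qy, hanti, hσ1, fun _ => hσl⟩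

end CHn
end
end

section
/- Let (p, x, σ, β) be admissible parameters with z = p − Σ_{i=1}^{n−1} x_i²/σ_i > 0. The inner product on 𝔠𝔥(n) given by S(p, x, σ, β) is Einstein, i.e. its Ricci form satisfies Ric(U,V) = c·⟨U,V⟩ for some constant c ∈ ℝ and all U, V ∈ 𝔠𝔥(n), if and only if pβ = 1, x_i = 0 for all i, and σ_i = 1 for all i; equivalently, if and only if S(p, x, σ, β) = diag(p, 1, …, 1, 1/p). -/
noncomputable section

open Matrix BigOperators Finset

namespace CHn

/-- Index type of the blocks. -/
abbrev Idx (n : ℕ) := Unit ⊕ (Fin (n - 1) ⊕ (Fin (n - 1) ⊕ Unit))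

/-- Index map. -/
def ix (n : ℕ) (hn : 2 ≤ n) : Idx n → Fin (2 * n)
  | .inl _ => ⟨0, by omega⟩
  | .inr (.inl i) => ⟨i.val + 1, by omega⟩
  | .inr (.inr (.inl i)) => ⟨i.val + n, by omega⟩
  | .inr (.inr (.inr _)) => ⟨2 * n - 1, by omega⟩

theorem ix_bij (n : ℕ) (hn : 2 ≤ n) : Function.Bijective (ix n hn) := by
  constructor
  · rintro (a | a | a | a) (b | b | b | b) h <;> simp [ix] at h ⊢ <;> omega
  · intro k
    by_cases h0 : k.val = 0
    · exact ⟨.inl (), Fin.ext (by simp [ix, h0])⟩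
    by_cases h1 : k.val ≤ n - 1
    · exact ⟨.inr (.inl ⟨k.val - 1, by omega⟩), Fin.ext (by simp [ix]; omega)⟩
    by_cases h2 : k.val ≤ 2 * n - 2
    · exact ⟨.inr (.inr (.inl ⟨k.val - n, by omega⟩)), Fin.ext (by simp [ix]; omega)⟩
    · exact ⟨.inr (.inr (.inr ())), Fin.ext (by simp [ix]; omega)⟩

theorem sum_split (n : ℕ) (hn : 2 ≤ n) (f : Fin (2 * n) → ℝ) :
    ∑ t, f t = f (ix n hn (.inl ())) + (∑ i, f (ix n hn (.inr (.inl i)))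
      + (∑ i, f (ix n hn (.inr (.inr (.inl i)))) + f (ix n hn (.inr (.inr (.inr ())))))) := by
  rw [← (ix_bij n hn).sum_comp]
  simp

/-- Structure constants on blocks. -/
def sc (n : ℕ) : Idx n → Idx n → Idx n → ℝ
  | .inl _, .inr (.inl i), .inr (.inl j) => if i = j then 1 / 2 else 0
  | .inr (.inl i), .inl _, .inr (.inl j) => if i = j then - (1 / 2) else 0
  | .inl _, .inr (.inr (.inl i)), .inr (.inr (.inl j)) => if i = j then 1 / 2 else 0
  | .inr (.inr (.inl i)), .inl _, .inr (.inr (.inl j)) => if i = j then - (1 / 2) else 0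
  | .inl _, .inr (.inr (.inr _)), .inr (.inr (.inr _)) => 1
  | .inr (.inr (.inr _)), .inl _, .inr (.inr (.inr _)) => -1
  | .inr (.inr (.inl i)), .inr (.inl j), .inr (.inr (.inr _)) => if i = j then 1 else 0
  | .inr (.inl i), .inr (.inr (.inl j)), .inr (.inr (.inr _)) => if i = j then -1 else 0
  | _, _, _ => 0

/-- Value of the index map. -/
def ixv (n : ℕ) : Idx n → ℕ
  | .inl _ => 0
  | .inr (.inl i) => i.val + 1
  | .inr (.inr (.inl i)) => i.val + n
  | .inr (.inr (.inr _)) => 2 * n - 1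

theorem ix_val (n : ℕ) (hn : 2 ≤ n) (a : Idx n) : (ix n hn a).val = ixv n a := by
  rcases a with a | a | a | a <;> rfl

/-- Structure constants on naturals. -/
def scN (n : ℕ) (i j k : ℕ) : ℝ :=
  (if i = 0 ∧ j = k ∧ 1 ≤ j ∧ j ≤ 2 * n - 2 then (1 : ℝ) / 2 else 0)
  - (if j = 0 ∧ i = k ∧ 1 ≤ i ∧ i ≤ 2 * n - 2 then (1 : ℝ) / 2 else 0)
  + (if i = 0 ∧ j = 2 * n - 1 ∧ k = 2 * n - 1 then (1 : ℝ) else 0)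
  - (if j = 0 ∧ i = 2 * n - 1 ∧ k = 2 * n - 1 then (1 : ℝ) else 0)
  + (if n ≤ i ∧ i ≤ 2 * n - 2 ∧ i = j + (n - 1) ∧ k = 2 * n - 1
      then (1 : ℝ) else 0)
  - (if n ≤ j ∧ j ≤ 2 * n - 2 ∧ j = i + (n - 1) ∧ k = 2 * n - 1
      then (1 : ℝ) else 0)

theorem structC_eq (n : ℕ) (i j k : Fin (2 * n)) : structC n i j k = scN n i.val j.val k.val := by
  simp only [structC, scN, Fin.ext_iff]

set_option maxHeartbeats 4000000 in
theorem structC_ix (n : ℕ) (hn : 2 ≤ n) (a b c : Idx n) :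
    structC n (ix n hn a) (ix n hn b) (ix n hn c) = sc n a b c := by
  rw [structC_eq, ix_val, ix_val, ix_val]
  rcases a with a | a | a | a <;> rcases b with b | b | b | b <;> rcases c with c | c | c | c <;>
    (try by_cases h1 : a.val = b.val) <;> (try by_cases h2 : a.val = c.val) <;>
    (try by_cases h3 : b.val = c.val) <;>
    dsimp only [ixv, sc] <;> unfold scN <;> (try simp only [Fin.ext_iff]) <;>
    simp (disch := omega) only [if_neg, if_pos, and_true, true_and] <;> norm_num

/-- Metric on blocks. -/
def sm (n : ℕ) (p : ℝ) (x σ : Fin (n - 1) → ℝ) (β : ℝ) : Idx n → Idx n → ℝ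
  | .inl _, .inl _ => p
  | .inl _, .inr (.inl i) => x i
  | .inr (.inl i), .inl _ => x i
  | .inr (.inl i), .inr (.inl j) => if i = j then σ i else 0
  | .inr (.inr (.inl i)), .inr (.inr (.inl j)) => if i = j then σ i else 0
  | .inr (.inr (.inr _)), .inr (.inr (.inr _)) => β
  | _, _ => 0

/-- Metric on naturals. -/
def smN (n : ℕ) (hn : 2 ≤ n) (p : ℝ) (x σ : Fin (n - 1) → ℝ) (β : ℝ) (a b : ℕ) : ℝ :=
  if a = 0 ∧ b = 0 then p
  else if h : a = 0 ∧ 1 ≤ b ∧ b ≤ n - 1 then x ⟨b - 1, by omega⟩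
  else if h : b = 0 ∧ 1 ≤ a ∧ a ≤ n - 1 then x ⟨a - 1, by omega⟩
  else if h : a = b ∧ 1 ≤ a ∧ a ≤ n - 1 then σ ⟨a - 1, by omega⟩
  else if h : a = b ∧ n ≤ a ∧ a ≤ 2 * n - 2 then σ ⟨a - n, by omega⟩
  else if a = b ∧ a = 2 * n - 1 then β
  else 0

theorem Sform_eq (n : ℕ) (hn : 2 ≤ n) (p : ℝ) (x σ : Fin (n - 1) → ℝ) (β : ℝ) (i j : Fin (2 * n)) :
    Sform n p x σ β i j = smN n hn p x σ β i.val j.val := by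
  simp only [Sform, smN, Fin.ext_iff]

set_option maxHeartbeats 4000000 in
theorem Sform_ix (n : ℕ) (hn : 2 ≤ n) (p : ℝ) (x σ : Fin (n - 1) → ℝ) (β : ℝ) (a b : Idx n) :
    Sform n p x σ β (ix n hn a) (ix n hn b) = sm n p x σ β a b := by
  rw [Sform_eq n hn, ix_val, ix_val]
  rcases a with a | a | a | a <;> rcases b with b | b | b | b <;>
    (try by_cases h1 : a.val = b.val) <;>
    dsimp only [ixv, sm] <;> unfold smN <;> (try simp only [Fin.ext_iff]) <;>
    simp (disch := omega) only [dif_neg, dif_pos, if_neg, if_pos, and_true, true_and] <;>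
    first | rfl | (congr 1; apply Fin.ext; simp)

/-- Model vectors, coordinates with respect to `(X', Y, Z, W)`. -/
@[ext] structure MV (n : ℕ) where
  x : ℝ
  y : Fin (n - 1) → ℝ
  z : Fin (n - 1) → ℝ
  w : ℝ

/-- coordinates on blocks. -/
def co (n : ℕ) (a : Fin (n - 1) → ℝ) (u : MV n) : Idx n → ℝ
  | .inl _ => u.x
  | .inr (.inl i) => u.y i - a i * u.x
  | .inr (.inr (.inl i)) => u.z i
  | .inr (.inr (.inr _)) => u.w

/-- The vector with given model coordinates. -/
def phi (n : ℕ) (hn : 2 ≤ n) (a : Fin (n - 1) → ℝ) (u : MV n) : Fin (2 * n) → ℝ :=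
  fun k => co n a u ((Equiv.ofBijective _ (ix_bij n hn)).symm k)

theorem phi_ix (n : ℕ) (hn : 2 ≤ n) (a : Fin (n - 1) → ℝ) (u : MV n) (b : Idx n) :
    phi n hn a u (ix n hn b) = co n a u b := by
  have : (Equiv.ofBijective _ (ix_bij n hn)).symm (ix n hn b) = b :=
    (Equiv.ofBijective _ (ix_bij n hn)).symm_apply_apply b
  simp [phi, this]

theorem ext_ix {n : ℕ} (hn : 2 ≤ n) {u v : Fin (2 * n) → ℝ}
    (h : ∀ b, u (ix n hn b) = v (ix n hn b)) : u = v := by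
  funext k
  obtain ⟨b, rfl⟩ := (ix_bij n hn).2 k
  exact h b

theorem phi_surj (n : ℕ) (hn : 2 ≤ n) (a : Fin (n - 1) → ℝ) (u : Fin (2 * n) → ℝ) :
    ∃ m, phi n hn a m = u := by
  refine ⟨⟨u (ix n hn (.inl ())), fun i => u (ix n hn (.inr (.inl i))) + a i * u (ix n hn (.inl ())),
    fun i => u (ix n hn (.inr (.inr (.inl i)))), u (ix n hn (.inr (.inr (.inr ()))))⟩, ?_⟩
  apply ext_ix hn
  rintro (b | b | b | b) <;> simp [phi_ix, co]

/-- model bracket. -/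
def mB {n : ℕ} (a : Fin (n - 1) → ℝ) (u v : MV n) : MV n where
  x := 0
  y i := (u.x * v.y i - v.x * u.y i) / 2
  z i := (u.x * v.z i - v.x * u.z i) / 2
  w := u.x * v.w - v.x * u.w + ∑ i, (a i * (u.x * v.z i - v.x * u.z i)
        + (u.z i * v.y i - v.z i * u.y i))

/-- model inner product. -/
def mI {n : ℕ} (ζ : ℝ) (σ : Fin (n - 1) → ℝ) (β : ℝ) (u v : MV n) : ℝ :=
  ζ * u.x * v.x + β * u.w * v.w + ∑ i, σ i * (u.y i * v.y i + u.z i * v.z i)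

/-- model Levi-Civita product. -/
def mN {n : ℕ} (ζ : ℝ) (a σ : Fin (n - 1) → ℝ) (β : ℝ) (u v : MV n) : MV n where
  x := (2 * ζ)⁻¹ * (2 * β * u.w * v.w + ∑ i, (σ i * (u.y i * v.y i + u.z i * v.z i)
        + β * a i * (v.z i * u.w + u.z i * v.w)))
  y i := - v.x * u.y i / 2 - β / (2 * σ i) * (v.z i * u.w + u.z i * v.w)
  z i := - v.x * u.z i / 2 - β / (2 * σ i) * ((v.x * u.w + u.x * v.w) * a i - v.y i * u.w - u.y i * v.w)
  w := - v.x * u.w + (∑ i, (a i * (u.x * v.z i - v.x * u.z i)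
        + (u.z i * v.y i - v.z i * u.y i))) / 2

theorem bracket_phi (n : ℕ) (hn : 2 ≤ n) (a : Fin (n - 1) → ℝ) (u v : MV n) :
    bracket n (phi n hn a u) (phi n hn a v) = phi n hn a (mB a u v) := by
  apply ext_ix hn
  intro b
  simp only [bracket, sum_split n hn, structC_ix, phi_ix]
  rcases b with b | b | b | b
  · simp [sc, co, mB]
  · simp [sc, co, mB]; ring
  · simp [sc, co, mB]; ring
  · simp [sc, co, mB]
    have key : ∑ i, (a i * (u.x * v.z i - v.x * u.z i) + (u.z i * v.y i - v.z i * u.y i))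
        = (∑ i, u.z i * (v.y i - a i * v.x)) - ∑ i, (u.y i - a i * u.x) * v.z i := by
      rw [← Finset.sum_sub_distrib]
      exact Finset.sum_congr rfl fun i _ => by ring
    rw [key]
    ring

theorem ip_phi (n : ℕ) (hn : 2 ≤ n) (p β : ℝ) (x σ : Fin (n - 1) → ℝ) (hσ : ∀ i, σ i ≠ 0)
    (u v : MV n) :
    ip n (Sform n p x σ β) (phi n hn (fun i => x i / σ i) u) (phi n hn (fun i => x i / σ i) v)
      = mI (zval n p x σ) σ β u v := by
  simp only [ip, dotProduct, Matrix.mulVec, sum_split n hn, Sform_ix, phi_ix]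
  simp [sm, co, mI, zval]
  have key : u.x * (∑ i, x i * (v.y i - x i / σ i * v.x)) +
      ((∑ i, (u.y i - x i / σ i * u.x) * (x i * v.x + σ i * (v.y i - x i / σ i * v.x))) +
        (∑ i, u.z i * (σ i * v.z i))) =
      - (∑ i, x i ^ 2 / σ i) * (u.x * v.x) + ∑ i, σ i * (u.y i * v.y i + u.z i * v.z i) := by
    simp only [Finset.mul_sum, Finset.sum_mul, ← Finset.sum_add_distrib, ← Finset.sum_neg_distrib]
    refine Finset.sum_congr rfl fun i _ => ?_
    have := hσ i
    field_simp
    ring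
  linear_combination key

theorem mK {n : ℕ} (ζ : ℝ) (a σ : Fin (n - 1) → ℝ) (β : ℝ) (hζ : ζ ≠ 0) (hσ : ∀ i, σ i ≠ 0)
    (u v T : MV n) :
    mI ζ σ β (mB a u v) T - mI ζ σ β (mB a v T) u + mI ζ σ β (mB a T u) v
      = 2 * mI ζ σ β (mN ζ a σ β u v) T := by
  have key : ∀ A1 A2 A3 P1 P2 P3 Q R : ℝ,
      P1 - β * u.w * A2 - P2 + β * v.w * A3 + P3 = Q * T.x + 2 * R →
      ζ * 0 * T.x + β * (u.x * v.w - v.x * u.w + A1) * T.w + P1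
      - (ζ * 0 * u.x + β * (v.x * T.w - T.x * v.w + A2) * u.w + P2)
      + (ζ * 0 * v.x + β * (T.x * u.w - u.x * T.w + A3) * v.w + P3)
      = 2 * (ζ * ((2 * ζ)⁻¹ * (2 * β * u.w * v.w + Q)) * T.x
        + β * (- v.x * u.w + A1 / 2) * T.w + R) := by
    intro A1 A2 A3 P1 P2 P3 Q R h
    have h2 : 2 * (ζ * ((2 * ζ)⁻¹ * (2 * β * u.w * v.w + Q)) * T.x)
        = (2 * β * u.w * v.w + Q) * T.x := by
      field_simp
    linear_combination h - h2
  simp only [mI, mB, mN]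
  apply key
  simp only [Finset.mul_sum, Finset.sum_mul, ← Finset.sum_add_distrib, ← Finset.sum_sub_distrib]
  refine Finset.sum_congr rfl fun i _ => ?_
  have := hσ i
  field_simp
  ring

end CHn
namespace CHn

/-- Standard basis vectors in model coordinates. -/
def bs {n : ℕ} (a : Fin (n - 1) → ℝ) : Idx n → MV n
  | .inl _ => ⟨1, a, 0, 0⟩
  | .inr (.inl i) => ⟨0, Pi.single i 1, 0, 0⟩
  | .inr (.inr (.inl i)) => ⟨0, 0, Pi.single i 1, 0⟩
  | .inr (.inr (.inr _)) => ⟨0, 0, 0, 1⟩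

theorem single_ix (n : ℕ) (hn : 2 ≤ n) (a : Fin (n - 1) → ℝ) (b : Idx n) :
    (Pi.single (ix n hn b) 1 : Fin (2 * n) → ℝ) = phi n hn a (bs a b) := by
  apply ext_ix hn
  intro c
  rw [phi_ix]
  simp only [Pi.single_apply, (ix_bij n hn).1.eq_iff]
  rcases b with b | b | b | b <;> rcases c with c | c | c | c <;>
    simp [bs, co, Pi.single_apply]

theorem mI_comm {n : ℕ} (ζ : ℝ) (σ : Fin (n - 1) → ℝ) (β : ℝ) (u v : MV n) :
    mI ζ σ β u v = mI ζ σ β v u := by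
  simp only [mI]
  congr 1
  · ring
  · exact Finset.sum_congr rfl fun i _ => by ring

theorem Smul_phi (n : ℕ) (hn : 2 ≤ n) (p β : ℝ) (x σ : Fin (n - 1) → ℝ) (hσ : ∀ i, σ i ≠ 0)
    (u : MV n) (b : Idx n) :
    (Sform n p x σ β).mulVec (phi n hn (fun i => x i / σ i) u) (ix n hn b)
      = mI (zval n p x σ) σ β (bs (fun i => x i / σ i) b) u := by
  rw [← ip_phi n hn p β x σ hσ, ← single_ix, ip, single_dotProduct, one_mul]

theorem S_unit (n : ℕ) (hn : 2 ≤ n) (p β : ℝ) (x σ : Fin (n - 1) → ℝ) (hσ : ∀ i, σ i ≠ 0)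
    (hβ : β ≠ 0) (hz : zval n p x σ ≠ 0) : IsUnit (Sform n p x σ β) := by
  rw [← Matrix.mulVec_injective_iff_isUnit]
  apply (injective_iff_map_eq_zero (Matrix.mulVecLin (Sform n p x σ β))).2
  intro v hv
  obtain ⟨u, rfl⟩ := phi_surj n hn (fun i => x i / σ i) v
  rw [Matrix.mulVecLin_apply] at hv
  have h : ∀ b, mI (zval n p x σ) σ β (bs (fun i => x i / σ i) b) u = 0 := by
    intro b
    rw [← Smul_phi n hn p β x σ hσ, hv]
    rfl
  have hy : ∀ i, u.y i = 0 := fun i => by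
    have := h (.inr (.inl i))
    simpa [mI, bs, Pi.single_apply, hσ] using this
  have hzz : ∀ i, u.z i = 0 := fun i => by
    have := h (.inr (.inr (.inl i)))
    simpa [mI, bs, Pi.single_apply, hσ] using this
  have hw : u.w = 0 := by
    have := h (.inr (.inr (.inr ())))
    simpa [mI, bs, hβ] using this
  have hx : u.x = 0 := by
    have := h (.inl ())
    simpa [mI, bs, hz, hy] using this
  apply ext_ix hn
  intro b
  rw [phi_ix]
  rcases b with b | b | b | b <;> simp [co, hy, hzz, hw, hx]

theorem nabla_phi (n : ℕ) (hn : 2 ≤ n) (p β : ℝ) (x σ : Fin (n - 1) → ℝ) (hσ : ∀ i, σ i ≠ 0)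
    (hβ : β ≠ 0) (hz : zval n p x σ ≠ 0) (u v : MV n) :
    nabla n (Sform n p x σ β) (phi n hn (fun i => x i / σ i) u) (phi n hn (fun i => x i / σ i) v)
      = phi n hn (fun i => x i / σ i) (mN (zval n p x σ) (fun i => x i / σ i) σ β u v) := by
  have hk : koszul n (Sform n p x σ β) (phi n hn (fun i => x i / σ i) u)
      (phi n hn (fun i => x i / σ i) v) = (2 : ℝ) • (Sform n p x σ β).mulVec
        (phi n hn (fun i => x i / σ i) (mN (zval n p x σ) (fun i => x i / σ i) σ β u v)) := by
    apply ext_ix hn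
    intro b
    rw [Pi.smul_apply, Smul_phi n hn p β x σ hσ, mI_comm, smul_eq_mul, ← mK _ _ _ _ hz hσ, koszul]
    simp only [single_ix n hn (fun i => x i / σ i), bracket_phi, ip_phi n hn p β x σ hσ]
  have hu := S_unit n hn p β x σ hσ hβ hz
  rw [nabla, hk, Matrix.mulVec_smul, smul_smul, Matrix.mulVec_mulVec,
    Matrix.nonsing_inv_mul _ ((Matrix.isUnit_iff_isUnit_det _).1 hu), Matrix.one_mulVec]
  norm_num

/-- difference of model vectors. -/
def mD {n : ℕ} (u v : MV n) : MV n := ⟨u.x - v.x, u.y - v.y, u.z - v.z, u.w - v.w⟩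

theorem phi_mD (n : ℕ) (hn : 2 ≤ n) (a : Fin (n - 1) → ℝ) (u v : MV n) :
    phi n hn a (mD u v) = phi n hn a u - phi n hn a v := by
  apply ext_ix hn
  intro b
  rw [Pi.sub_apply, phi_ix, phi_ix, phi_ix]
  rcases b with b | b | b | b <;> simp [co, mD]
  ring

/-- model curvature. -/
def mC {n : ℕ} (ζ : ℝ) (a σ : Fin (n - 1) → ℝ) (β : ℝ) (u v w : MV n) : MV n :=
  mD (mD (mN ζ a σ β u (mN ζ a σ β v w)) (mN ζ a σ β v (mN ζ a σ β u w)))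
    (mN ζ a σ β (mB a u v) w)

/-- model Ricci form. -/
def mR {n : ℕ} (ζ : ℝ) (a σ : Fin (n - 1) → ℝ) (β : ℝ) (u v : MV n) : ℝ :=
  (mC ζ a σ β (bs a (.inl ())) u v).x + (∑ j, ((mC ζ a σ β (bs a (.inr (.inl j))) u v).y j
    - a j * (mC ζ a σ β (bs a (.inr (.inl j))) u v).x)
   + (∑ j, (mC ζ a σ β (bs a (.inr (.inr (.inl j)))) u v).z j
     + (mC ζ a σ β (bs a (.inr (.inr (.inr ())))) u v).w))

theorem ricci_phi (n : ℕ) (hn : 2 ≤ n) (p β : ℝ) (x σ : Fin (n - 1) → ℝ) (hσ : ∀ i, σ i ≠ 0)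
    (hβ : β ≠ 0) (hz : zval n p x σ ≠ 0) (u v : MV n) :
    ricci n (Sform n p x σ β) (phi n hn (fun i => x i / σ i) u) (phi n hn (fun i => x i / σ i) v)
      = mR (zval n p x σ) (fun i => x i / σ i) σ β u v := by
  have hc : ∀ b, curv n (Sform n p x σ β) (Pi.single (ix n hn b) 1)
      (phi n hn (fun i => x i / σ i) u) (phi n hn (fun i => x i / σ i) v) =
      phi n hn (fun i => x i / σ i) (mC (zval n p x σ) (fun i => x i / σ i) σ β
        (bs (fun i => x i / σ i) b) u v) := by
    intro b
    rw [curv, single_ix n hn (fun i => x i / σ i)]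
    simp only [bracket_phi, nabla_phi n hn p β x σ hσ hβ hz, mC, phi_mD]
  rw [ricci, sum_split n hn]
  simp only [hc, phi_ix, co, mR]

theorem mR_ZW {n : ℕ} (hn : 2 ≤ n) (ζ : ℝ) (a σ : Fin (n - 1) → ℝ) (β : ℝ) (hζ : ζ ≠ 0)
    (hσ : ∀ i, σ i ≠ 0) (k : Fin (n - 1)) :
    mR ζ a σ β ⟨0, 0, Pi.single k 1, 0⟩ ⟨0, 0, 0, 1⟩ = - (2 * n + 1) / (4 * ζ) * (a k * β) := by
  simp [mR, mC, mD, mN, mB, bs, Pi.single_apply]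
  have hn1 : ((n - 1 : ℕ) : ℝ) = n - 1 := by
    rw [Nat.cast_sub (by omega)]
    norm_num
  have h1 : ∑ x, β * a x * ((if x = k then (1 : ℝ) else 0) / 2) = β * a k / 2 := by
    simp [ite_div, mul_ite]
    ring
  have h2 : ∑ x, a x * (((-if k = x then ζ⁻¹ * 2⁻¹ * (σ k * (β / (2 * σ k))) else 0) -
      if x = k then ζ⁻¹ * 2⁻¹ * (σ x * (β / (2 * σ x))) else 0) +
      if x = k then ζ⁻¹ * 2⁻¹ * (2 * β) else 0) =
      a k * (- (ζ⁻¹ * 2⁻¹ * (σ k * (β / (2 * σ k)))) - ζ⁻¹ * 2⁻¹ * (σ k * (β / (2 * σ k)))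
        + ζ⁻¹ * 2⁻¹ * (2 * β)) := by
    rw [Finset.sum_eq_single k]
    · simp
    · intro b _ hb
      simp [hb, hb.symm]
    · simp
  have h3 : ∑ x, (if x = k then -(ζ⁻¹ * 2⁻¹ * (β * a x)) else 0) / 2
      = -(ζ⁻¹ * 2⁻¹ * (β * a k)) / 2 := by
    simp [ite_div]
  rw [h1, h2, h3, hn1]
  have := hσ k
  field_simp
  ring

theorem mR_zero {n : ℕ} (hn : 2 ≤ n) (ζ : ℝ) (σ : Fin (n - 1) → ℝ) (β : ℝ) (hζ : ζ ≠ 0)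
    (hσ : ∀ i, σ i ≠ 0) (u v : MV n) :
    mR ζ 0 σ β u v = - (n + 1) / 2 * (u.x * v.x)
      - ∑ i, (β / (2 * σ i) + n * σ i / (2 * ζ)) * (u.y i * v.y i + u.z i * v.z i)
      + (β ^ 2 / 2 * (∑ i, 1 / (σ i) ^ 2) - n * β / ζ) * (u.w * v.w) := by
  simp [mR, mC, mD, mN, mB, bs, Pi.single_apply]
  have hn1 : ((n - 1 : ℕ) : ℝ) = n - 1 := by
    rw [Nat.cast_sub (by omega)]
    norm_num
  set P := ∑ i, σ i * (u.y i * v.y i + u.z i * v.z i) with hP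
  set Q := ∑ i, (σ i)⁻¹ * (u.y i * v.y i) with hQ
  set Q' := ∑ i, (σ i)⁻¹ * (u.z i * v.z i) with hQ'
  set H := ∑ i, ((σ i) ^ 2)⁻¹ with hH
  have e1 : ∑ i, σ i * (u.y i / 2 * v.y i + u.z i / 2 * v.z i) = P / 2 := by
    rw [hP, Finset.sum_div]
    exact Finset.sum_congr rfl fun i _ => by ring
  have e2 : ∑ i, -(ζ⁻¹ * 2⁻¹ * (σ i * v.y i) * u.y i) / 2
      + ∑ i, -(ζ⁻¹ * 2⁻¹ * (σ i * v.z i) * u.z i) / 2 = - (ζ⁻¹ / 4) * P := by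
    rw [hP, Finset.mul_sum, ← Finset.sum_add_distrib]
    exact Finset.sum_congr rfl fun i _ => by ring
  have e3 : ∑ i, β / (2 * σ i) * (β / (2 * σ i) * v.w * u.w + u.z i * (-v.z i / 2))
      = β ^ 2 / 4 * (u.w * v.w) * H - β / 4 * Q' := by
    rw [hH, hQ', Finset.mul_sum, Finset.mul_sum, ← Finset.sum_sub_distrib]
    exact Finset.sum_congr rfl fun i _ => by ring
  have e4 : ∑ i, β / (2 * σ i) * (β / (2 * σ i) * v.w * u.w - u.y i * (v.y i / 2))
      = β ^ 2 / 4 * (u.w * v.w) * H - β / 4 * Q := by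
    rw [hH, hQ, Finset.mul_sum, Finset.mul_sum, ← Finset.sum_sub_distrib]
    exact Finset.sum_congr rfl fun i _ => by ring
  have e5 : ∑ i, (-(v.x * (-u.x / 2)) / 2 + β / (2 * σ i) * (v.z i * u.z i))
      = (n - 1) * (u.x * v.x / 4) + β / 2 * Q' := by
    rw [Finset.sum_add_distrib, Finset.sum_const, Finset.card_univ, Fintype.card_fin, nsmul_eq_mul,
      hn1, hQ', Finset.mul_sum]
    congr 1
    · ring
    · exact Finset.sum_congr rfl fun i _ => by ring
  have e6 : ∑ i, (-(v.x * (-u.x / 2)) / 2 + β / (2 * σ i) * (v.y i * u.y i))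
      = (n - 1) * (u.x * v.x / 4) + β / 2 * Q := by
    rw [Finset.sum_add_distrib, Finset.sum_const, Finset.card_univ, Fintype.card_fin, nsmul_eq_mul,
      hn1, hQ, Finset.mul_sum]
    congr 1
    · ring
    · exact Finset.sum_congr rfl fun i _ => by ring
  have e7 : ∑ i, u.z i * (β / (2 * σ i) * v.z i) = β / 2 * Q' := by
    rw [hQ', Finset.mul_sum]
    exact Finset.sum_congr rfl fun i _ => by ring
  have e8 : ∑ i, β / (2 * σ i) * v.y i * u.y i = β / 2 * Q := by
    rw [hQ, Finset.mul_sum]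
    exact Finset.sum_congr rfl fun i _ => by ring
  have e9 : ∑ i, (β / (2 * σ i) + ↑n * σ i / (2 * ζ)) * (u.y i * v.y i + u.z i * v.z i)
      = β / 2 * Q + β / 2 * Q' + n * ζ⁻¹ / 2 * P := by
    rw [hQ, hQ', hP, Finset.mul_sum, Finset.mul_sum, Finset.mul_sum, ← Finset.sum_add_distrib,
      ← Finset.sum_add_distrib]
    exact Finset.sum_congr rfl fun i _ => by ring
  rw [e1, e3, e4, e5, e6, e7, e8, e9, hn1]
  linear_combination - e2


/-- The left invariant metric `g(p,x,σ,β)` on `CH(n)` is Einstein iff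
`pβ = 1`, all `x_i = 0` and all `σ_i = 1`; equivalently iff
`S(p,x,σ,β) = diag(p, 1, …, 1, 1/p)`. -/
theorem einstein_iff (n : ℕ) (hn : 2 ≤ n) (p β : ℝ) (x σ : Fin (n - 1) → ℝ)
    (hadm : Admissible n p x σ β) (hz : 0 < zval n p x σ) :
    (IsEinstein n (Sform n p x σ β) ↔
      (p * β = 1 ∧ (∀ i, x i = 0) ∧ ∀ i, σ i = 1)) ∧
    (IsEinstein n (Sform n p x σ β) ↔
      Sform n p x σ β = Matrix.diagonal (fun k : Fin (2 * n) =>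
        if k.val = 0 then p else if k.val = 2 * n - 1 then 1 / p else 1)) := by
  obtain ⟨hp, hβ, -, -, hσ1, hlast⟩ := hadm
  have hσp : ∀ i, 0 < σ i := fun i => lt_of_lt_of_le one_pos (hσ1 i)
  have hσ : ∀ i, σ i ≠ 0 := fun i => (hσp i).ne'
  have hn1 : ((n - 1 : ℕ) : ℝ) = n - 1 := by
    rw [Nat.cast_sub (by omega)]
    norm_num
  have hnpos : (0 : ℝ) < n := by exact_mod_cast (by omega : 0 < n)
  have hA : IsEinstein n (Sform n p x σ β) ↔ (p * β = 1 ∧ (∀ i, x i = 0) ∧ ∀ i, σ i = 1) := by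
    have hiff : IsEinstein n (Sform n p x σ β) ↔ ∃ c, ∀ u v,
        mR (zval n p x σ) (fun i => x i / σ i) σ β u v = c * mI (zval n p x σ) σ β u v := by
      constructor
      · rintro ⟨c, hc⟩
        refine ⟨c, fun u v => ?_⟩
        have := hc (phi n hn (fun i => x i / σ i) u) (phi n hn (fun i => x i / σ i) v)
        rwa [ricci_phi n hn p β x σ hσ hβ.ne' hz.ne', ip_phi n hn p β x σ hσ] at this
      · rintro ⟨c, hc⟩
        refine ⟨c, fun u v => ?_⟩
        obtain ⟨u, rfl⟩ := phi_surj n hn (fun i => x i / σ i) u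
        obtain ⟨v, rfl⟩ := phi_surj n hn (fun i => x i / σ i) v
        rw [ricci_phi n hn p β x σ hσ hβ.ne' hz.ne', ip_phi n hn p β x σ hσ, hc]
    rw [hiff]
    constructor
    · rintro ⟨c, hc⟩
      have hx : ∀ i, x i = 0 := by
        intro k
        have h := hc ⟨0, 0, Pi.single k 1, 0⟩ ⟨0, 0, 0, 1⟩
        rw [mR_ZW hn _ _ _ _ hz.ne' hσ] at h
        have h0 : mI (zval n p x σ) σ β ⟨0, 0, Pi.single k 1, 0⟩ ⟨0, 0, 0, 1⟩ = 0 := by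
          simp [mI]
        rw [h0, mul_zero] at h
        have h1 : - (2 * (n : ℝ) + 1) / (4 * zval n p x σ) ≠ 0 :=
          div_ne_zero (by linarith) (by linarith)
        have h2 := (mul_eq_zero.1 h).resolve_left h1
        have h3 := (mul_eq_zero.1 h2).resolve_right hβ.ne'
        exact (div_eq_zero_iff.1 h3).resolve_right (hσ k)
      have hx0 : (fun i => x i / σ i) = 0 := by
        funext i
        simp [hx i]
      have hzp : zval n p x σ = p := by simp [zval, hx]
      rw [hx0, hzp] at hc
      have hY : ∀ i, - (β / (2 * σ i) + n * σ i / (2 * p)) = c * σ i := by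
        intro k
        have h := hc ⟨0, Pi.single k 1, 0, 0⟩ ⟨0, Pi.single k 1, 0, 0⟩
        rw [mR_zero hn _ _ _ hp.ne' hσ] at h
        simpa [mI, Pi.single_apply] using h
      have hl := hlast (by omega)
      have hL := hY ⟨n - 2, by omega⟩
      rw [hl] at hL
      have hs : ∀ i, σ i = 1 := by
        intro i
        have h := hY i
        have hc' : c = - (β / 2 + n / (2 * p)) := by linear_combination - hL
        rw [hc'] at h
        have h5 := hσ i
        have h6 := hp.ne'
        have h7 : β * p * (σ i ^ 2 - 1) = 0 := by
          field_simp at h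
          linarith
        have h8 := (mul_eq_zero.1 h7).resolve_left (mul_pos hβ hp).ne'
        nlinarith [hσ1 i]
      refine ⟨?_, hx, hs⟩
      have h := hc ⟨0, 0, 0, 1⟩ ⟨0, 0, 0, 1⟩
      rw [mR_zero hn _ _ _ hp.ne' hσ] at h
      have h' : β ^ 2 / 2 * (n - 1) - n * β / p = c * β := by
        simpa [mI, hs, hn1] using h
      have hc' : c = - (β / 2 + n / (2 * p)) := by linear_combination - hL
      rw [hc'] at h'
      have h6 := hp.ne'
      field_simp at h'
      have h9 : n * (p * β - 1) = 0 := by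
        linear_combination h'
      have := (mul_eq_zero.1 h9).resolve_left hnpos.ne'
      linarith
    · rintro ⟨hpb, hx, hs⟩
      have hx0 : (fun i => x i / σ i) = 0 := by
        funext i
        simp [hx i]
      have hzp : zval n p x σ = p := by simp [zval, hx]
      refine ⟨- (n + 1) / (2 * p), fun u v => ?_⟩
      rw [hx0, hzp, mR_zero hn _ _ _ hp.ne' hσ]
      have hb : β = p⁻¹ := eq_inv_of_mul_eq_one_right hpb
      simp only [mI, hs, mul_add, Finset.mul_sum]
      rw [hb]
      have h6 := hp.ne'
      have e1 : ∑ i, ((p⁻¹ / (2 * 1) + ↑n * 1 / (2 * p)) * (u.y i * v.y i)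
          + (p⁻¹ / (2 * 1) + ↑n * 1 / (2 * p)) * (u.z i * v.z i))
        = - ∑ i, (- (n + 1) / (2 * p) * (1 * (u.y i * v.y i))
          + - (n + 1) / (2 * p) * (1 * (u.z i * v.z i))) := by
        rw [← Finset.sum_neg_distrib]
        refine Finset.sum_congr rfl fun i _ => ?_
        field_simp
        ring
      rw [e1]
      simp only [Finset.sum_const, Finset.card_univ, Fintype.card_fin, nsmul_eq_mul, hn1]
      field_simp
      ring
  refine ⟨hA, hA.trans ?_⟩
  constructor
  · rintro ⟨hpb, hx, hs⟩
    have hb : β = 1 / p := by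
      field_simp
      linarith
    ext i j
    obtain ⟨a, rfl⟩ := (ix_bij n hn).2 i
    obtain ⟨b, rfl⟩ := (ix_bij n hn).2 j
    rw [Sform_ix, Matrix.diagonal_apply]
    simp only [(ix_bij n hn).1.eq_iff, ix_val]
    have hone : ∀ k, k ≠ 0 → k ≠ 2 * n - 1 →
        (if k = 0 then p else if k = 2 * n - 1 then 1 / p else 1) = 1 := by
      intro k h1 h2
      rw [if_neg h1, if_neg h2]
    rcases a with a | a | a | a <;> rcases b with b | b | b | b
    case inl.inl => simp [sm, ixv]
    case inr.inr.inr.inr.inr.inr =>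
      have h2 : ¬ (2 * n - 1 = 0) := by omega
      simp [sm, ixv, h2, hb]
    case inr.inl.inr.inl =>
      rw [hone _ (by dsimp only [ixv]; omega) (by dsimp only [ixv]; omega)]
      simp [sm, hs]
    case inr.inr.inl.inr.inr.inl =>
      rw [hone _ (by dsimp only [ixv]; omega) (by dsimp only [ixv]; omega)]
      simp [sm, hs]
    all_goals simp [sm, hx]
  · intro h
    have hd : ∀ a, Sform n p x σ β (ix n hn a) (ix n hn a) =
        if ixv n a = 0 then p else if ixv n a = 2 * n - 1 then 1 / p else 1 := by
      intro a
      rw [h, Matrix.diagonal_apply_eq, ix_val]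
    refine ⟨?_, fun i => ?_, fun i => ?_⟩
    · have := hd (.inr (.inr (.inr ())))
      rw [Sform_ix] at this
      rw [if_neg (show ¬ ixv n (.inr (.inr (.inr ()))) = 0 by dsimp only [ixv]; omega),
        if_pos (show ixv n (.inr (.inr (.inr ()))) = 2 * n - 1 from rfl)] at this
      have hb : β = 1 / p := this
      rw [hb]
      field_simp
    · have := congrFun (congrFun h (ix n hn (.inl ()))) (ix n hn (.inr (.inl i)))
      rw [Sform_ix, Matrix.diagonal_apply_ne _ (by simp [(ix_bij n hn).1.eq_iff])] at this
      exact this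
    · have := hd (.inr (.inl i))
      rw [Sform_ix] at this
      rw [if_neg (show ¬ ixv n (.inr (.inl i)) = 0 by dsimp only [ixv]; omega),
        if_neg (show ¬ ixv n (.inr (.inl i)) = 2 * n - 1 by dsimp only [ixv]; omega)] at this
      simpa [sm] using this

end CHn
end
end

section
/- If S and S′ are symmetric positive definite 2n×2n real matrices defining inner products on 𝔠𝔥(n) that are both Einstein, i.e. their Ricci forms satisfy Ric_S = c·S and Ric_{S′} = c′·S′ for some constants c, c′ ∈ ℝ, then there exist a real number r > 0 and F ∈ Aut(𝔠𝔥(n)) such that S′ = r·FᵀSF. (The Einstein left invariant metric on CH(n) is unique up to the action of the automorphism group and scaling.) -/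
noncomputable section

open Matrix BigOperators Finset

namespace CHn

abbrev Ix (m : ℕ) := Unit ⊕ Fin m ⊕ Unit

noncomputable def xx {m : ℕ} (p : ℝ) : Ix m → ℝ
  | Sum.inl _ => p
  | _ => 0
noncomputable def TT {m : ℕ} (p : ℝ) (b : Fin m → ℝ) (Om : Fin m → Fin m → ℝ) : Ix m → Ix m → ℝ
  | Sum.inl _, Sum.inl _ => 0
  | Sum.inl _, Sum.inr (Sum.inl i) => b i
  | Sum.inl _, Sum.inr (Sum.inr _) => p/2
  | Sum.inr (Sum.inl i), Sum.inl _ => - b i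
  | Sum.inr (Sum.inl i), Sum.inr (Sum.inl j) => Om i j
  | Sum.inr (Sum.inl _), Sum.inr (Sum.inr _) => 0
  | Sum.inr (Sum.inr _), Sum.inl _ => -(p/2)
  | Sum.inr (Sum.inr _), Sum.inr (Sum.inl _) => 0
  | Sum.inr (Sum.inr _), Sum.inr (Sum.inr _) => 0
noncomputable def dd {m : ℕ} (i j : Ix m) : ℝ := if i = j then 1 else 0

noncomputable def cc {m : ℕ} (p : ℝ) (b : Fin m → ℝ) (Om : Fin m → Fin m → ℝ) (i j k : Ix m) : ℝ :=
  1/2 * (xx p i * dd j k - xx p j * dd i k) + TT p b Om i j * dd k (Sum.inr (Sum.inr ()))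
noncomputable def GG {m : ℕ} (p : ℝ) (b : Fin m → ℝ) (Om : Fin m → Fin m → ℝ) (i j k : Ix m) : ℝ :=
  1/2 * (cc p b Om i j k - cc p b Om j k i + cc p b Om k i j)
noncomputable def RR {m : ℕ} (p : ℝ) (b : Fin m → ℝ) (Om : Fin m → Fin m → ℝ) (i j : Ix m) : ℝ :=
  ∑ t, ∑ k, (GG p b Om i j k * GG p b Om t k t - GG p b Om t j k * GG p b Om i k t
    - cc p b Om t i k * GG p b Om k j t)

lemma RR_iZ {m : ℕ} (p : ℝ) (b : Fin m → ℝ) (Om : Fin m → Fin m → ℝ)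
    (hO : ∀ i j, Om j i = - Om i j) (i : Fin m) :
    RR p b Om (Sum.inr (Sum.inl i)) (Sum.inr (Sum.inr ())) = - p * b i * (m + 3) / 4 := by
  have h0 : ∀ i, Om i i = 0 := fun i => by linarith [hO i i]
  simp [RR, GG, cc, xx, TT, dd, Fintype.sum_sum_type, h0, hO i, Finset.sum_add_distrib, Finset.sum_sub_distrib, 
   Finset.sum_ite_eq, mul_ite, ite_mul, eq_comm]
  ring_nf
  simp [mul_ite, ite_mul, ← Finset.sum_mul]
  ring

lemma RR_AA {m : ℕ} (p : ℝ)  (Om : Fin m → Fin m → ℝ)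
    (hO : ∀ i j, Om j i = - Om i j) :
    RR p 0 Om (Sum.inl ()) (Sum.inl ()) = - p^2 * (m + 4) / 4 := by
  have h0 : ∀ i, Om i i = 0 := fun i => by linarith [hO i i]
  simp [RR, GG, cc, xx, TT, dd, Fintype.sum_sum_type, h0,  Finset.sum_add_distrib, Finset.sum_sub_distrib, 
   Finset.sum_ite_eq, mul_ite, ite_mul, eq_comm]
  ring_nf

lemma RR_ij {m : ℕ} (p : ℝ)  (Om : Fin m → Fin m → ℝ)
    (hO : ∀ i j, Om j i = - Om i j) (i j : Fin m) :
    RR p 0 Om (Sum.inr (Sum.inl i)) (Sum.inr (Sum.inl j)) = - (1/2) * (∑ k, Om i k * Om j k)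
      - (m+2) / 4 * p^2 * (if i = j then 1 else 0) := by
  have h0 : ∀ i, Om i i = 0 := fun i => by linarith [hO i i]
  simp [RR, GG, cc, xx, TT, dd, Fintype.sum_sum_type, h0,  Finset.sum_add_distrib, Finset.sum_sub_distrib, 
   Finset.sum_ite_eq, mul_ite, ite_mul, eq_comm]
  ring_nf
  have e1 : ∀ x, Om x j = - Om j x := fun x => hO _ _
  have e2 : ∀ x, Om x i = - Om i x := fun x => hO _ _
  have e3 : ∀ x, Om j x * Om i x = Om i x * Om j x := fun x => mul_comm _ _
  have e4 : ∀ x, ((if j = x then p * (1 / 2) else 0) * if i = x then p * (1 / 2) else 0)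
      = if j = x then (if i = j then p^2 / 4 else 0) else 0 := fun x => by
    by_cases h : j = x
    · subst h
      by_cases h' : i = j
      · simp [h']
        ring
      · simp [h']
    · simp [h]
  simp only [e1, e2, e3, e4, ← Finset.sum_mul, Finset.sum_neg_distrib, neg_mul_neg, neg_mul, mul_neg]
  simp only [Finset.sum_ite_eq, Finset.mem_univ, if_true]
  split_ifs <;> ring

/-- Darboux: unitary frame for an orthogonal complex structure. -/
lemma darboux_frame {U : Type*} [NormedAddCommGroup U] [InnerProductSpace ℝ U]
    [FiniteDimensional ℝ U] (J : U →ₗ[ℝ] U) (hJ : ∀ u v, inner ℝ (J u) v = - inner ℝ u (J v))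
    (k : ℕ) (hk : 2 * k ≤ Module.finrank ℝ U) :
    ∃ y : Fin k → U, (∀ i j, inner ℝ (y i) (y j) = if i = j then (1:ℝ) else 0) ∧
      ∀ i j, inner ℝ (y i) (J (y j)) = 0 := by
  induction k with
  | zero => exact ⟨Fin.elim0, fun i => i.elim0, fun i => i.elim0⟩
  | succ k ih =>
    obtain ⟨y, hy1, hy2⟩ := ih (by omega)
    have hlt : (Submodule.span ℝ (Set.range (Sum.elim y (fun i => J (y i))))) ≠ ⊤ := by
      intro h
      have := finrank_range_le_card (R := ℝ) (Sum.elim y (fun i => J (y i)))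
      rw [Set.finrank, h, finrank_top] at this
      simp at this
      omega
    obtain ⟨v, hv, hv0⟩ := (Submodule.ne_bot_iff _).1
      (fun h => hlt ((Submodule.orthogonal_eq_bot_iff).1 h))
    set v' : U := (‖v‖⁻¹ : ℝ) • v with hv'
    have hvv : inner ℝ v' v' = (1:ℝ) := by
      rw [real_inner_self_eq_norm_sq, norm_smul]
      have := norm_ne_zero_iff.2 hv0
      simp [this]
    have h1 : ∀ i, inner ℝ (y i) v' = 0 := fun i => by
      rw [hv', inner_smul_right, (Submodule.mem_orthogonal _ _).1 hv (y i)
        (Submodule.subset_span ⟨Sum.inl i, rfl⟩), mul_zero]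
    have h2 : ∀ i, inner ℝ (J (y i)) v' = 0 := fun i => by
      rw [hv', inner_smul_right, (Submodule.mem_orthogonal _ _).1 hv (J (y i))
        (Submodule.subset_span ⟨Sum.inr i, rfl⟩), mul_zero]
    have h0 : ∀ u, inner ℝ u (J u) = 0 := fun u => by
      have := hJ u u
      rw [real_inner_comm] at this
      linarith
    refine ⟨Fin.cons v' y, ?_, ?_⟩
    · intro i j
      refine Fin.cases ?_ (fun i => ?_) i <;> refine Fin.cases ?_ (fun j => ?_) j
      · simpa using hvv
      · simp [real_inner_comm, h1, (Fin.succ_ne_zero _).symm]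
      · simp [h1]
      · simp [hy1]
    · intro i j
      refine Fin.cases ?_ (fun i => ?_) i <;> refine Fin.cases ?_ (fun j => ?_) j
      · simp [h0]
      · simp only [Fin.cons_succ, Fin.cons_zero]
        rw [real_inner_comm]
        exact h2 j
      · have := hJ (y i) v'
        simp only [Fin.cons_succ, Fin.cons_zero]
        linarith [h2 i]
      · simp [hy2]

open scoped MatrixOrder in
lemma posDef_factor {ι : Type*} [Fintype ι] [DecidableEq ι] (S : Matrix ι ι ℝ) (hS : S.PosDef) :
    ∃ B : Matrix ι ι ℝ, IsUnit B ∧ S = Bᵀ * B := by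
  obtain ⟨B, hB⟩ := CStarAlgebra.nonneg_iff_eq_star_mul_self.1 hS.posSemidef.nonneg
  have : S = Bᵀ * B := by
    rw [hB, Matrix.star_eq_conjTranspose, Matrix.conjTranspose_eq_transpose_of_trivial]
  refine ⟨B, ?_, this⟩
  have h2 := hS.isUnit
  rw [this] at h2
  exact isUnit_of_mul_isUnit_right h2

noncomputable def th0 {k : ℕ} : Unit ⊕ (Fin k ⊕ Fin k) ⊕ Unit → Unit ⊕ (Fin k ⊕ Fin k) ⊕ Unit → ℝ
  | Sum.inl _, Sum.inr (Sum.inr _) => 1 / 2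
  | Sum.inr (Sum.inr _), Sum.inl _ => - (1 / 2)
  | Sum.inr (Sum.inl (Sum.inr i)), Sum.inr (Sum.inl (Sum.inl j)) => if i = j then 1 else 0
  | Sum.inr (Sum.inl (Sum.inl i)), Sum.inr (Sum.inl (Sum.inr j)) => if i = j then -1 else 0
  | _, _ => 0

lemma adapted_basis {V : Type*} [NormedAddCommGroup V] [InnerProductSpace ℝ V]
    [FiniteDimensional ℝ V] (m : ℕ) (hd : Module.finrank ℝ V = m + 2)
    (th : V →ₗ[ℝ] V →ₗ[ℝ] ℝ) (W : V) (hth : ∀ u v, th u v = - th v u)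
    (hW : ∃ u, th u W ≠ 0) :
    ∃ (p q : ℝ) (e : OrthonormalBasis (Ix m) ℝ V), 0 < p ∧ 0 < q ∧
      W = q • e (Sum.inr (Sum.inr ())) ∧ ∀ i, th (e i) W = xx p i / 2 := by
  obtain ⟨u0, hu0⟩ := hW
  have hWW : th W W = 0 := by linarith [hth W W]
  have hW0 : W ≠ 0 := by rintro rfl; simp at hu0
  let A' : V := (InnerProductSpace.toDual ℝ V).symm (LinearMap.toContinuousLinearMap (th.flip W))
  have hA' : ∀ u, inner ℝ A' u = th u W := fun u => by
    simp [A']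
  have hA0 : A' ≠ 0 := by
    intro h
    apply hu0
    rw [← hA', h, inner_zero_left]
  have hAn : ‖A'‖ ≠ 0 := norm_ne_zero_iff.2 hA0
  have hWn : ‖W‖ ≠ 0 := norm_ne_zero_iff.2 hW0
  let v : Ix m → V := fun i => match i with
    | Sum.inl _ => ‖A'‖⁻¹ • A'
    | Sum.inr (Sum.inl _) => 0
    | Sum.inr (Sum.inr _) => ‖W‖⁻¹ • W
  let s : Set (Ix m) := {Sum.inl (), Sum.inr (Sum.inr ())}
  have hAW : inner ℝ A' W = 0 := by rw [hA', hWW]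
  have hWA : inner ℝ W A' = 0 := by rw [real_inner_comm, hAW]
  have hv : Orthonormal ℝ (s.domRestrict v) := by
    constructor
    · rintro ⟨i, hi⟩
      rcases hi with rfl | hi
      · simp [v, norm_smul, hAn]
      · rw [Set.mem_singleton_iff] at hi
        subst hi
        simp [v, norm_smul, hWn]
    · rintro ⟨i, hi⟩ ⟨j, hj⟩ hij
      rcases hi with rfl | hi <;> rcases hj with rfl | hj
      · simp at hij
      · rw [Set.mem_singleton_iff] at hj
        subst hj
        simp [v, inner_smul_left, inner_smul_right, hAW]
      · rw [Set.mem_singleton_iff] at hi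
        subst hi
        simp [v, inner_smul_left, inner_smul_right, hWA]
      · rw [Set.mem_singleton_iff] at hi hj
        subst hi
        subst hj
        simp at hij
  obtain ⟨e, he⟩ := hv.exists_orthonormalBasis_extension_of_card_eq (by
    rw [hd]
    simp
    omega)
  have heA : e (Sum.inl ()) = ‖A'‖⁻¹ • A' := he _ (by simp [s])
  have heZ : e (Sum.inr (Sum.inr ())) = ‖W‖⁻¹ • W := he _ (by simp [s])
  have heA' : A' = ‖A'‖ • e (Sum.inl ()) := by rw [heA, smul_smul, mul_inv_cancel₀ hAn, one_smul]
  refine ⟨2 * ‖A'‖, ‖W‖, e, by positivity, by positivity, ?_, ?_⟩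
  · rw [heZ, smul_smul, mul_inv_cancel₀ hWn, one_smul]
  · intro i
    rw [← hA', heA', inner_smul_left, e.inner_eq_ite]
    rcases i with i | i | i
    · simp [xx, norm_smul]
    · simp [xx]
    · simp [xx]

lemma einstein_conditions {V : Type*} [NormedAddCommGroup V] [InnerProductSpace ℝ V]
    [FiniteDimensional ℝ V] (m : ℕ)
    (th : V →ₗ[ℝ] V →ₗ[ℝ] ℝ) (W : V) (hth : ∀ u v, th u v = - th v u)
    (br nab : V →ₗ[ℝ] V →ₗ[ℝ] V)
    (hbr : ∀ u v, br u v = th u W • v - th v W • u + th u v • W)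
    (hnab : ∀ u v t, 2 * inner ℝ (nab u v) t
      = inner ℝ (br u v) t - inner ℝ (br v t) u + inner ℝ (br t u) v)
    (c : ℝ) (hE : ∀ u v, LinearMap.trace ℝ V (nab.flip (nab u v) - (nab u) ∘ₗ (nab.flip v)
      - (nab.flip v) ∘ₗ (br.flip u)) = c * inner ℝ u v)
    (p q : ℝ) (e : OrthonormalBasis (Ix m) ℝ V) (hp : 0 < p) (hq : 0 < q)
    (hWe : W = q • e (Sum.inr (Sum.inr ()))) (hx : ∀ i, th (e i) W = xx p i / 2) :
    (∀ i, th (e (Sum.inl ())) (e (Sum.inr (Sum.inl i))) = 0) ∧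
    ∀ i j, ∑ k, (q * th (e (Sum.inr (Sum.inl i))) (e (Sum.inr (Sum.inl k)))) *
      (q * th (e (Sum.inr (Sum.inl j))) (e (Sum.inr (Sum.inl k)))) =
        p ^ 2 * (if i = j then 1 else 0) := by
  set b : Fin m → ℝ := fun i => q * th (e (Sum.inl ())) (e (Sum.inr (Sum.inl i))) with hb
  set Om : Fin m → Fin m → ℝ := fun i j =>
    q * th (e (Sum.inr (Sum.inl i))) (e (Sum.inr (Sum.inl j))) with hOm
  have hO : ∀ i j, Om j i = - Om i j := fun i j => by
    simp only [hOm]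
    rw [hth]
    ring
  have h0 : ∀ u, th u u = 0 := fun u => by linarith [hth u u]
  have hZ : ∀ i, q * th (e i) (e (Sum.inr (Sum.inr ()))) = xx p i / 2 := fun i => by
    rw [← hx i, hWe, map_smul, smul_eq_mul]
  have hZ' : ∀ i, q * th (e (Sum.inr (Sum.inr ()))) (e i) = - (xx p i / 2) := fun i => by
    rw [← hZ i, hth]
    ring
  have hT : ∀ i j, q * th (e i) (e j) = TT p b Om i j := by
    rintro (i | i | i) (j | j | j)
    · simp [TT, h0]
    · simp [TT, hb]
    · simp only [TT]
      exact hZ _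
    · simp only [TT, hb]
      rw [hth]
      ring
    · simp [TT, hOm]
    · simp only [TT]
      rw [hZ]
      simp [xx]
    · simp only [TT]
      exact hZ' _
    · simp only [TT]
      rw [hZ']
      simp [xx]
    · simp [TT, h0]
  have hin : ∀ i j, inner ℝ (e i) (e j) = dd i j := fun i j => by
    rw [e.inner_eq_ite, dd]
  have hc : ∀ i j k, inner ℝ (br (e i) (e j)) (e k) = cc p b Om i j k := fun i j k => by
    rw [hbr, inner_add_left, inner_sub_left, inner_smul_left, inner_smul_left, inner_smul_left,
      hx, hx, hin, hin, cc, ← hT]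
    nth_rewrite 1 [hWe]
    rw [inner_smul_left, hin]
    have : dd (Sum.inr (Sum.inr ())) k = dd k (Sum.inr (Sum.inr ())) := by simp [dd, eq_comm]
    rw [this]
    simp
    ring
  have hG : ∀ i j k, inner ℝ (nab (e i) (e j)) (e k) = GG p b Om i j k := fun i j k => by
    have := hnab (e i) (e j) (e k)
    rw [hc, hc, hc] at this
    rw [GG]
    linarith
  have exn : ∀ i j, nab (e i) (e j) = ∑ k, GG p b Om i j k • e k := fun i j => by
    rw [← e.sum_repr' (nab (e i) (e j))]
    refine Finset.sum_congr rfl fun k _ => ?_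
    rw [real_inner_comm, hG]
  have exb : ∀ i j, br (e i) (e j) = ∑ k, cc p b Om i j k • e k := fun i j => by
    rw [← e.sum_repr' (br (e i) (e j))]
    refine Finset.sum_congr rfl fun k _ => ?_
    rw [real_inner_comm, hc]
  have hR : ∀ i j, RR p b Om i j = c * dd i j := fun i j => by
    rw [← hin, ← hE, LinearMap.trace_eq_sum_inner _ e, RR]
    refine Finset.sum_congr rfl fun t _ => ?_
    simp only [LinearMap.sub_apply, LinearMap.comp_apply, LinearMap.flip_apply]
    rw [exn i j, exn t j, exb t i]
    simp only [map_sum, map_smul, LinearMap.sum_apply, LinearMap.smul_apply, inner_sub_right,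
      inner_sum, inner_smul_right, Finset.sum_sub_distrib, real_inner_comm (nab _ _), hG]
  have hb0 : b = 0 := by
    funext i
    have h1 := hR (Sum.inr (Sum.inl i)) (Sum.inr (Sum.inr ()))
    rw [RR_iZ p b Om hO] at h1
    simp [dd] at h1
    have h2 : (m : ℝ) + 3 ≠ 0 := by positivity
    rcases h1 with (h1 | h1) | h1
    · exact absurd h1 hp.ne'
    · exact h1
    · exact absurd h1 h2
  rw [hb0] at hR
  constructor
  · intro i
    have := congrFun hb0 i
    simpa [hb, hq.ne'] using this
  · intro i j
    have h1 := hR (Sum.inl ()) (Sum.inl ())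
    have h2 := hR (Sum.inr (Sum.inl i)) (Sum.inr (Sum.inl j))
    rw [RR_AA p Om hO] at h1
    rw [RR_ij p Om hO] at h2
    have h3 : c = - p^2 * (m + 4) / 4 := by simpa [dd] using h1.symm
    have h4 : dd (Sum.inr (Sum.inl i) : Ix m) (Sum.inr (Sum.inl j)) = if i = j then 1 else 0 := by
      simp [dd]
    rw [h4, h3] at h2
    change ∑ k, Om i k * Om j k = _
    linarith

lemma einstein_frame {V : Type*} [NormedAddCommGroup V] [InnerProductSpace ℝ V]
    [FiniteDimensional ℝ V] (k : ℕ) (hd : Module.finrank ℝ V = 2 * k + 2)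
    (th : V →ₗ[ℝ] V →ₗ[ℝ] ℝ) (W : V) (hth : ∀ u v, th u v = - th v u)
    (hW : ∃ u, th u W ≠ 0)
    (br nab : V →ₗ[ℝ] V →ₗ[ℝ] V)
    (hbr : ∀ u v, br u v = th u W • v - th v W • u + th u v • W)
    (hnab : ∀ u v t, 2 * inner ℝ (nab u v) t
      = inner ℝ (br u v) t - inner ℝ (br v t) u + inner ℝ (br t u) v)
    (c : ℝ) (hE : ∀ u v, LinearMap.trace ℝ V (nab.flip (nab u v) - (nab u) ∘ₗ (nab.flip v)
      - (nab.flip v) ∘ₗ (br.flip u)) = c * inner ℝ u v) :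
    ∃ (p lam : ℝ) (f : Unit ⊕ (Fin k ⊕ Fin k) ⊕ Unit → V), 0 < p ∧ lam ≠ 0 ∧
      f (Sum.inr (Sum.inr ())) = lam • W ∧
      (∀ a b, th (f a) (f b) = lam * th0 a b) ∧
      ∀ a b, p ^ 2 * inner ℝ (f a) (f b) = if a = b then 1 else 0 := by
  obtain ⟨p, q, e, hp, hq, hWe, hx⟩ := adapted_basis (2 * k) hd th W hth hW
  obtain ⟨hA, hOO⟩ := einstein_conditions (2 * k) th W hth br nab hbr hnab c hE p q e hp hq hWe hx
  have hp0 := hp.ne'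
  have hq0 := hq.ne'
  have h0 : ∀ u, th u u = 0 := fun u => by linarith [hth u u]
  let w : Fin (2 * k) → V := fun i => e (Sum.inr (Sum.inl i))
  let Om : Matrix (Fin (2 * k)) (Fin (2 * k)) ℝ := fun i j => q / p * th (w i) (w j)
  have hOd : ∀ i j, Om i j = q / p * th (w i) (w j) := fun i j => rfl
  clear_value Om
  have hOt : Omᵀ = - Om := by
    ext i j
    simp only [Matrix.transpose_apply, Matrix.neg_apply, hOd]
    rw [hth (w j)]
    ring
  have hOm2 : Om * Omᵀ = 1 := by
    ext i j
    have := hOO i j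
    rw [Matrix.mul_apply, Matrix.one_apply]
    have h2 : ∑ x, Om i x * Omᵀ x j = 
        (∑ k, (q * th (w i) (w k)) * (q * th (w j) (w k))) / p ^ 2 := by
      rw [Finset.sum_div]
      refine Finset.sum_congr rfl fun x _ => ?_
      simp only [Matrix.transpose_apply, hOd]
      field_simp
    rw [h2, this]
    field_simp
  let J : EuclideanSpace ℝ (Fin (2 * k)) →ₗ[ℝ] EuclideanSpace ℝ (Fin (2 * k)) := Matrix.toEuclideanLin Om
  have hinU : ∀ a b : EuclideanSpace ℝ (Fin (2 * k)), inner ℝ a b = ∑ i, a i * b i := fun a b => by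
    simp [PiLp.inner_apply, mul_comm]
  have hJapp : ∀ (a : EuclideanSpace ℝ (Fin (2 * k))) i, J a i = ∑ j, Om i j * a j := fun a i => by
    simp [J, Matrix.toEuclideanLin, Matrix.mulVec, dotProduct]
  have hJ : ∀ u v : EuclideanSpace ℝ (Fin (2 * k)), inner ℝ (J u) v = - inner ℝ u (J v) := fun u v => by
    rw [hinU, hinU]
    simp only [hJapp, Finset.sum_mul, Finset.mul_sum]
    rw [Finset.sum_comm, ← Finset.sum_neg_distrib]
    refine Finset.sum_congr rfl fun i _ => ?_
    rw [← Finset.sum_neg_distrib]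
    refine Finset.sum_congr rfl fun j _ => ?_
    have := congrFun (congrFun hOt i) j
    simp only [Matrix.transpose_apply, Matrix.neg_apply] at this
    rw [this]
    ring
  have hJ2 : ∀ u, J (J u) = - u := fun u => by
    have h1 : Om * Om = -1 := by
      rw [hOt, mul_neg] at hOm2
      rw [← hOm2, neg_neg]
    ext i
    have h2 : J (J u) i = ∑ j, (Om * Om) i j * u j := by
      simp only [hJapp, Matrix.mul_apply, Finset.mul_sum, Finset.sum_mul]
      rw [Finset.sum_comm]
      refine Finset.sum_congr rfl fun i _ => Finset.sum_congr rfl fun j _ => by ring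
    rw [h2, h1]
    simp [Matrix.one_apply]
  obtain ⟨y, hy1, hy2⟩ := darboux_frame J hJ k (by simp)
  let psi : EuclideanSpace ℝ (Fin (2 * k)) → V := fun a => ∑ i, a i • w i
  have hin : ∀ i j, inner ℝ (e i) (e j) = if i = j then (1 : ℝ) else 0 := e.inner_eq_ite
  have psi_in : ∀ a b, inner ℝ (psi a) (psi b) = inner ℝ a b := fun a b => by
    rw [hinU]
    simp only [psi, sum_inner, inner_sum, inner_smul_left, inner_smul_right, w, hin]
    simp [mul_comm]
  have psi_th : ∀ a b, th (psi a) (psi b) = p / q * inner ℝ a (J b) := fun a b => by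
    rw [hinU]
    simp only [psi, map_sum, map_smul, LinearMap.sum_apply, LinearMap.smul_apply, hJapp,
      smul_eq_mul, Finset.mul_sum]
    rw [Finset.sum_comm]
    refine Finset.sum_congr rfl fun i _ => Finset.sum_congr rfl fun j _ => ?_
    simp only [hOd]
    field_simp
  have psi_A : ∀ a, inner ℝ (e (Sum.inl ())) (psi a) = 0 := fun a => by
    simp only [psi, inner_sum, inner_smul_right, w, hin]
    simp
  have psi_Z : ∀ a, inner ℝ (e (Sum.inr (Sum.inr ()))) (psi a) = 0 := fun a => by
    simp only [psi, inner_sum, inner_smul_right, w, hin]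
    simp
  have psi_A' : ∀ a, inner ℝ (psi a) (e (Sum.inl ())) = 0 := fun a => by
    rw [real_inner_comm, psi_A]
  have psi_Z' : ∀ a, inner ℝ (psi a) (e (Sum.inr (Sum.inr ()))) = 0 := fun a => by
    rw [real_inner_comm, psi_Z]
  have th_A : ∀ a, th (e (Sum.inl ())) (psi a) = 0 := fun a => by
    simp only [psi, map_sum, map_smul, w, hA]
    simp
  have th_A' : ∀ a, th (psi a) (e (Sum.inl ())) = 0 := fun a => by
    rw [hth, th_A, neg_zero]
  have hZ : ∀ i, th (e i) (e (Sum.inr (Sum.inr ()))) = xx p i / 2 / q := fun i => by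
    rw [← hx i, hWe, map_smul, smul_eq_mul]
    field_simp
  have th_Z' : ∀ a, th (psi a) (e (Sum.inr (Sum.inr ()))) = 0 := fun a => by
    simp only [psi, map_sum, map_smul, LinearMap.sum_apply, LinearMap.smul_apply, w, hZ]
    simp [xx]
  have th_Z : ∀ a, th (e (Sum.inr (Sum.inr ()))) (psi a) = 0 := fun a => by
    rw [hth, th_Z', neg_zero]
  have th_AZ : th (e (Sum.inl ())) (e (Sum.inr (Sum.inr ()))) = p / 2 / q := by
    rw [hZ, xx]
  have th_ZA : th (e (Sum.inr (Sum.inr ()))) (e (Sum.inl ())) = - (p / 2 / q) := by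
    rw [hth, th_AZ]
  have hJy : ∀ i j, inner ℝ (J (y i)) (J (y j)) = if i = j then (1:ℝ) else 0 := fun i j => by
    rw [hJ, hJ2, inner_neg_right, neg_neg, hy1]
  have hyJ : ∀ i j, inner ℝ (J (y i)) (y j) = 0 := fun i j => by
    rw [hJ, hy2, neg_zero]
  let f : Unit ⊕ (Fin k ⊕ Fin k) ⊕ Unit → V := fun a => p⁻¹ • (match a with
    | Sum.inl _ => e (Sum.inl ())
    | Sum.inr (Sum.inl (Sum.inl i)) => psi (y i)
    | Sum.inr (Sum.inl (Sum.inr i)) => psi (J (y i))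
    | Sum.inr (Sum.inr _) => e (Sum.inr (Sum.inr ())))
  refine ⟨p, (p * q)⁻¹, f, hp, by positivity, ?_, ?_, ?_⟩
  · simp only [f]
    rw [hWe, smul_smul]
    congr 1
    field_simp
  · intro a b
    simp only [f, map_smul, LinearMap.smul_apply, smul_eq_mul]
    rcases a with a | (a | a) | a <;> rcases b with b | (b | b) | b <;>
      simp only [th0, th_A, th_A', th_Z, th_Z', th_AZ, th_ZA, psi_th, hJ2, hy2, hJy, hyJ, h0,
        hy1, inner_neg_right] <;> (try split_ifs) <;> field_simp <;> simp
  · intro a b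
    simp only [f, inner_smul_left, inner_smul_right]
    rcases a with a | (a | a) | a <;> rcases b with b | (b | b) | b <;>
      simp [psi_A, psi_A', psi_Z, psi_Z', psi_in, hy1, hy2, hJy, hyJ, hin] <;>
      (try split_ifs) <;> field_simp

def tau (k : ℕ) : Unit ⊕ (Fin k ⊕ Fin k) ⊕ Unit → Fin (2 * (k + 1))
  | Sum.inl _ => ⟨0, by omega⟩
  | Sum.inr (Sum.inl (Sum.inl i)) => ⟨1 + i.val, by omega⟩
  | Sum.inr (Sum.inl (Sum.inr i)) => ⟨k + 1 + i.val, by omega⟩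
  | Sum.inr (Sum.inr _) => ⟨2 * k + 1, by omega⟩

lemma tau_bij (k : ℕ) : Function.Bijective (tau k) := by
  rw [Fintype.bijective_iff_injective_and_card]
  constructor
  · rintro (a | (a | a) | a) (b | (b | b) | b) h <;> simp only [tau, Fin.mk.injEq] at h <;>
      first
      | rfl
      | (exfalso; omega)
      | (have h' : a = b := Fin.ext (by omega)
         rw [h'])
  · simp
    omega

noncomputable def tauE (k : ℕ) : (Unit ⊕ (Fin k ⊕ Fin k) ⊕ Unit) ≃ Fin (2 * (k + 1)) :=
  Equiv.ofBijective _ (tau_bij k)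

set_option maxHeartbeats 4000000 in
lemma structC_tau (k : ℕ) (a b c : Unit ⊕ (Fin k ⊕ Fin k) ⊕ Unit) :
    structC (k + 1) (tau k a) (tau k b) (tau k c) =
      th0 a (Sum.inr (Sum.inr ())) * (if b = c then 1 else 0)
      - th0 b (Sum.inr (Sum.inr ())) * (if a = c then 1 else 0)
      + th0 a b * (if c = Sum.inr (Sum.inr ()) then 1 else 0) := by
  unfold structC
  rcases a with a | (a | a) | a <;> rcases b with b | (b | b) | b <;>
    rcases c with c | (c | c) | c <;>
    simp only [tau, th0, Sum.inl.injEq, Sum.inr.injEq, reduceCtorEq, Fin.ext_iff,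
      if_true, if_false] <;>
    grind

noncomputable def thE (k : ℕ) : (Fin (2 * (k + 1)) → ℝ) →ₗ[ℝ] (Fin (2 * (k + 1)) → ℝ) →ₗ[ℝ] ℝ :=
  Matrix.toLinearMap₂' ℝ (Matrix.of fun i j => th0 ((tauE k).symm i) ((tauE k).symm j))

noncomputable def Wv (k : ℕ) : Fin (2 * (k + 1)) → ℝ := Pi.single (tau k (Sum.inr (Sum.inr ()))) 1

lemma thE_single (k : ℕ) (a b : Unit ⊕ (Fin k ⊕ Fin k) ⊕ Unit) :
    thE k (Pi.single (tau k a) 1) (Pi.single (tau k b) 1) = th0 a b := by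
  have h : ∀ a, (tauE k).symm (tau k a) = a := fun a => (tauE k).symm_apply_apply a
  simp [thE, Matrix.toLinearMap₂'_apply, Pi.single_apply, h]

lemma th0_skew {k : ℕ} (a b : Unit ⊕ (Fin k ⊕ Fin k) ⊕ Unit) : th0 a b = - th0 b a := by
  rcases a with a | (a | a) | a <;> rcases b with b | (b | b) | b <;> simp [th0, eq_comm]
  all_goals (split_ifs <;> simp_all)

lemma tau_surj (k : ℕ) (i : Fin (2 * (k + 1))) : ∃ a, tau k a = i := (tau_bij k).2 i

lemma bilin_ext {k : ℕ} {M : Type*} [AddCommGroup M] [Module ℝ M]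
    (f g : (Fin (2 * (k + 1)) → ℝ) →ₗ[ℝ] (Fin (2 * (k + 1)) → ℝ) →ₗ[ℝ] M)
    (h : ∀ a b, f (Pi.single (tau k a) 1) (Pi.single (tau k b) 1)
      = g (Pi.single (tau k a) 1) (Pi.single (tau k b) 1)) : f = g := by
  refine LinearMap.ext_basis (Pi.basisFun ℝ _) (Pi.basisFun ℝ _) fun i j => ?_
  obtain ⟨a, rfl⟩ := tau_surj k i
  obtain ⟨b, rfl⟩ := tau_surj k j
  simpa using h a b

lemma thE_skew (k : ℕ) (u v) : thE k u v = - thE k v u := by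
  have : thE k = - (thE k).flip := bilin_ext _ _ fun a b => by
    rw [LinearMap.neg_apply, LinearMap.neg_apply, LinearMap.flip_apply, thE_single, thE_single,
      th0_skew]
  exact LinearMap.congr_fun (LinearMap.congr_fun this u) v

noncomputable def brL (n : ℕ) : (Fin (2 * n) → ℝ) →ₗ[ℝ] (Fin (2 * n) → ℝ) →ₗ[ℝ] (Fin (2 * n) → ℝ) :=
  LinearMap.mk₂ ℝ (bracket n)
    (fun u u' v => by
      funext k
      simp [bracket, add_mul, Finset.sum_add_distrib])
    (fun c u v => by
      funext k
      simp [bracket, Finset.mul_sum, mul_assoc])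
    (fun u v v' => by
      funext k
      simp [bracket, mul_add, add_mul, Finset.sum_add_distrib])
    (fun c u v => by
      funext k
      simp only [bracket, Finset.mul_sum, Pi.smul_apply, smul_eq_mul]
      refine Finset.sum_congr rfl fun i _ => Finset.sum_congr rfl fun j _ => by ring)

lemma brL_apply (n : ℕ) (u v) : brL n u v = bracket n u v := rfl

lemma bracket_single (n : ℕ) (i j k) : bracket n (Pi.single i 1) (Pi.single j 1) k = structC n i j k := by
  simp [bracket, Pi.single_apply, ite_mul]

lemma bracket_eq (k : ℕ) (u v) : bracket (k + 1) u v =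
    thE k u (Wv k) • v - thE k v (Wv k) • u + thE k u v • Wv k := by
  let R : (Fin (2 * (k + 1)) → ℝ) →ₗ[ℝ] (Fin (2 * (k + 1)) → ℝ) →ₗ[ℝ] (Fin (2 * (k + 1)) → ℝ) :=
    LinearMap.mk₂ ℝ (fun u v => thE k u (Wv k) • v - thE k v (Wv k) • u + thE k u v • Wv k)
    (fun u u' v => by simp only [map_add, LinearMap.add_apply]; module)
    (fun c u v => by simp only [map_smul, LinearMap.smul_apply, smul_eq_mul]; module)
    (fun u v v' => by simp only [map_add, LinearMap.add_apply]; module)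
    (fun c u v => by simp only [map_smul, LinearMap.smul_apply, smul_eq_mul]; module)
  have : brL (k + 1) = R := bilin_ext _ _ fun a b => by
    funext i
    obtain ⟨c, rfl⟩ := tau_surj k i
    rw [brL_apply, bracket_single, structC_tau]
    simp only [R, LinearMap.mk₂_apply, Wv, thE_single, Pi.add_apply, Pi.sub_apply, Pi.smul_apply,
      smul_eq_mul, Pi.single_apply, (tau_bij k).1.eq_iff]
    simp only [eq_comm]
  exact LinearMap.congr_fun (LinearMap.congr_fun this u) v

lemma ip_add_left (n : ℕ) (S) (u u' v) : ip n S (u + u') v = ip n S u v + ip n S u' v := by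
  simp [ip, add_dotProduct]
lemma ip_smul_left (n : ℕ) (S) (c : ℝ) (u v) : ip n S (c • u) v = c * ip n S u v := by
  simp [ip]
lemma ip_add_right (n : ℕ) (S) (u v v') : ip n S u (v + v') = ip n S u v + ip n S u v' := by
  simp [ip, Matrix.mulVec_add, dotProduct_add]
lemma ip_smul_right (n : ℕ) (S) (c : ℝ) (u v) : ip n S u (c • v) = c * ip n S u v := by
  simp [ip, Matrix.mulVec_smul]

noncomputable def ipL (n : ℕ) (S : Matrix (Fin (2 * n)) (Fin (2 * n)) ℝ) :
    (Fin (2 * n) → ℝ) →ₗ[ℝ] (Fin (2 * n) → ℝ) →ₗ[ℝ] ℝ :=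
  LinearMap.mk₂ ℝ (ip n S) (ip_add_left n S) (ip_smul_left n S) (ip_add_right n S)
    (ip_smul_right n S)

lemma br_add_left (n : ℕ) (u u' v) : bracket n (u + u') v = bracket n u v + bracket n u' v := by
  simp only [← brL_apply, map_add, LinearMap.add_apply]
lemma br_smul_left (n : ℕ) (c : ℝ) (u v) : bracket n (c • u) v = c • bracket n u v := by
  simp only [← brL_apply, map_smul, LinearMap.smul_apply]
lemma br_add_right (n : ℕ) (u v v') : bracket n u (v + v') = bracket n u v + bracket n u v' := by
  simp only [← brL_apply, map_add]
lemma br_smul_right (n : ℕ) (c : ℝ) (u v) : bracket n u (c • v) = c • bracket n u v := by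
  simp only [← brL_apply, map_smul]

noncomputable def nabL (n : ℕ) (S : Matrix (Fin (2 * n)) (Fin (2 * n)) ℝ) :
    (Fin (2 * n) → ℝ) →ₗ[ℝ] (Fin (2 * n) → ℝ) →ₗ[ℝ] (Fin (2 * n) → ℝ) :=
  LinearMap.mk₂ ℝ (nabla n S)
    (fun u u' v => by
      have : koszul n S (u + u') v = koszul n S u v + koszul n S u' v := by
        funext t
        simp only [koszul, br_add_left, br_add_right, ip_add_left, ip_add_right, Pi.add_apply]
        ring
      simp only [nabla, this, Matrix.mulVec_add, smul_add])
    (fun c u v => by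
      have : koszul n S (c • u) v = c • koszul n S u v := by
        funext t
        simp only [koszul, br_smul_left, br_smul_right, ip_smul_left, ip_smul_right,
          Pi.smul_apply, smul_eq_mul]
        ring
      simp only [nabla, this, Matrix.mulVec_smul]
      rw [smul_comm])
    (fun u v v' => by
      have : koszul n S u (v + v') = koszul n S u v + koszul n S u v' := by
        funext t
        simp only [koszul, br_add_left, br_add_right, ip_add_left, ip_add_right, Pi.add_apply]
        ring
      simp only [nabla, this, Matrix.mulVec_add, smul_add])
    (fun c u v => by
      have : koszul n S u (c • v) = c • koszul n S u v := by
        funext t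
        simp only [koszul, br_smul_left, br_smul_right, ip_smul_left, ip_smul_right,
          Pi.smul_apply, smul_eq_mul]
        ring
      simp only [nabla, this, Matrix.mulVec_smul]
      rw [smul_comm])

lemma nabL_apply (n : ℕ) (S u v) : nabL n S u v = nabla n S u v := rfl

lemma koszul_formula (n : ℕ) (S : Matrix (Fin (2 * n)) (Fin (2 * n)) ℝ) (hS : S.PosDef) (u v t) :
    2 * ip n S (nabla n S u v) t = ip n S (bracket n u v) t - ip n S (bracket n v t) u
      + ip n S (bracket n t u) v := by
  let K : (Fin (2 * n) → ℝ) →ₗ[ℝ] ℝ := ipL n S (bracket n u v)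
    - (ipL n S).flip u ∘ₗ brL n v + (ipL n S).flip v ∘ₗ (brL n).flip u
  have hK : ∀ t, K t = ip n S (bracket n u v) t - ip n S (bracket n v t) u
      + ip n S (bracket n t u) v := fun t => rfl
  have hk : koszul n S u v ⬝ᵥ t = K t := by
    conv_rhs => rw [← (Pi.basisFun ℝ (Fin (2 * n))).sum_repr t]
    simp only [map_sum, map_smul, Pi.basisFun_repr, Pi.basisFun_apply, smul_eq_mul]
    simp only [hK, dotProduct, koszul]
    refine Finset.sum_congr rfl fun i _ => mul_comm _ _
  have hT : Sᵀ = S := by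
    have := hS.isHermitian
    rwa [Matrix.IsHermitian, Matrix.conjTranspose_eq_transpose_of_trivial] at this
  rw [← hK, ← hk, ip, nabla, smul_dotProduct, Matrix.dotProduct_mulVec, ← Matrix.mulVec_transpose,
    hT, Matrix.mulVec_mulVec, Matrix.mul_nonsing_inv _ ((Matrix.isUnit_iff_isUnit_det _).1 hS.isUnit),
    Matrix.one_mulVec]
  simp

lemma ricci_trace (n : ℕ) (S : Matrix (Fin (2 * n)) (Fin (2 * n)) ℝ) (u v) :
    ricci n S u v = LinearMap.trace ℝ _ ((nabL n S).flip (nabL n S u v)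
      - (nabL n S u) ∘ₗ ((nabL n S).flip v) - ((nabL n S).flip v) ∘ₗ ((brL n).flip u)) := by
  rw [LinearMap.trace_eq_matrix_trace ℝ (Pi.basisFun ℝ (Fin (2 * n))), ricci, Matrix.trace]
  refine Finset.sum_congr rfl fun t _ => ?_
  rw [Matrix.diag_apply, LinearMap.toMatrix_apply]
  simp only [Pi.basisFun_repr, Pi.basisFun_apply]
  rfl

lemma ricci_bilin (k : ℕ) (S : Matrix (Fin (2 * (k + 1))) (Fin (2 * (k + 1))) ℝ) (c : ℝ)
    (hE : ∀ i j, ricci (k + 1) S (Pi.single i 1) (Pi.single j 1) = c * S i j) (u v) :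
    ricci (k + 1) S u v = c * ip (k + 1) S u v := by
  let R : (Fin (2 * (k + 1)) → ℝ) →ₗ[ℝ] (Fin (2 * (k + 1)) → ℝ) →ₗ[ℝ] ℝ :=
    LinearMap.mk₂ ℝ (ricci (k + 1) S)
    (fun u u' v => by
      simp only [ricci_trace, map_add, LinearMap.add_apply, LinearMap.add_comp,
        LinearMap.comp_add, map_sub]
      ring)
    (fun c u v => by
      simp only [ricci_trace, map_smul, LinearMap.smul_apply, LinearMap.smul_comp,
        LinearMap.comp_smul, map_sub, smul_eq_mul]
      ring)
    (fun u v v' => by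
      simp only [ricci_trace, map_add, LinearMap.add_apply, LinearMap.add_comp,
        LinearMap.comp_add, map_sub]
      ring)
    (fun c u v => by
      simp only [ricci_trace, map_smul, LinearMap.smul_apply, LinearMap.smul_comp,
        LinearMap.comp_smul, map_sub, smul_eq_mul]
      ring)
  have : R = c • ipL (k + 1) S := bilin_ext _ _ fun a b => by
    change ricci _ _ _ _ = c * ip _ _ _ _
    rw [hE, ip]
    simp
  exact LinearMap.congr_fun (LinearMap.congr_fun this u) v

lemma exists_normal (k : ℕ) (S : Matrix (Fin (2 * (k + 1))) (Fin (2 * (k + 1))) ℝ) (hS : S.PosDef)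
    (hE : ∃ c : ℝ, ∀ i j, ricci (k + 1) S (Pi.single i 1) (Pi.single j 1) = c * S i j) :
    ∃ (r : ℝ) (F : Matrix (Fin (2 * (k + 1))) (Fin (2 * (k + 1))) ℝ), 0 < r ∧ IsAut (k + 1) F ∧
      r • (Fᵀ * S * F) = 1 := by
  obtain ⟨c, hE⟩ := hE
  have hE' := ricci_bilin k S c hE
  obtain ⟨B, hB, hSB⟩ := posDef_factor S hS
  have hBd := (Matrix.isUnit_iff_isUnit_det _).1 hB
  let P : (Fin (2 * (k + 1)) → ℝ) ≃ₗ[ℝ] EuclideanSpace ℝ (Fin (2 * (k + 1))) :=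
    (Matrix.toLinearEquiv' B hB.invertible).trans (WithLp.linearEquiv 2 ℝ _).symm
  have hP : ∀ u v, inner ℝ (P u) (P v) = ip (k + 1) S u v := fun u v => by
    have h1 : ∀ u, P u = WithLp.toLp 2 (B *ᵥ u) := fun u => rfl
    rw [h1, h1, EuclideanSpace.inner_toLp_toLp, ip, hSB, ← Matrix.mulVec_mulVec,
      Matrix.dotProduct_mulVec, Matrix.vecMul_transpose]
    simp [dotProduct_comm]
  clear_value P
  have hP' : ∀ u v, inner ℝ u v = ip (k + 1) S (P.symm u) (P.symm v) := fun u v => by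
    rw [← hP]
    simp
  let th := (thE k).compl₁₂ P.symm.toLinearMap P.symm.toLinearMap
  let br := ((brL (k + 1)).compl₁₂ P.symm.toLinearMap P.symm.toLinearMap).compr₂ P.toLinearMap
  let nab := ((nabL (k + 1) S).compl₁₂ P.symm.toLinearMap P.symm.toLinearMap).compr₂ P.toLinearMap
  have hth : ∀ u v, th u v = thE k (P.symm u) (P.symm v) := fun u v => rfl
  have hbr : ∀ u v, br u v = P (bracket (k + 1) (P.symm u) (P.symm v)) := fun u v => rfl
  have hnab : ∀ u v, nab u v = P (nabla (k + 1) S (P.symm u) (P.symm v)) := fun u v => rfl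
  obtain ⟨p, lam, f, hp, hlam, hfW, hfth, hfin⟩ := einstein_frame k (by simp; ring) th (P (Wv k))
    (fun u v => by rw [hth, hth, thE_skew])
    ⟨P (Pi.single (tau k (Sum.inl ())) 1), by
      rw [hth]
      simp only [LinearEquiv.symm_apply_apply, Wv, thE_single]
      simp [th0]⟩
    br nab
    (fun u v => by
      rw [hbr, bracket_eq]
      simp [hth])
    (fun u v t => by
      simp only [hP', hbr, hnab, LinearEquiv.symm_apply_apply]
      exact koszul_formula (k + 1) S hS _ _ _)
    c
    (fun u v => by
      rw [hP', ← hE', ricci_trace, ← LinearMap.trace_conj' _ P]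
      congr 1
      ext1 x
      simp [LinearEquiv.conj_apply, hnab, hbr, nabL_apply, brL_apply])
  let F : Matrix (Fin (2 * (k + 1))) (Fin (2 * (k + 1))) ℝ :=
    Matrix.of fun i j => P.symm (f ((tauE k).symm j)) i
  have hF : ∀ a, F *ᵥ (Pi.single (tau k a) 1) = P.symm (f a) := fun a => by
    have h : (tauE k).symm (tau k a) = a := (tauE k).symm_apply_apply a
    rw [Matrix.mulVec_single_one]
    funext i
    simp [F, Matrix.col_apply, h]
  have hFth : ∀ u v, thE k (F *ᵥ u) (F *ᵥ v) = lam * thE k u v := fun u v => by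
    have : (thE k).compl₁₂ F.mulVecLin F.mulVecLin = lam • thE k := bilin_ext _ _ fun a b => by
      simp only [LinearMap.compl₁₂_apply, Matrix.mulVecLin_apply, LinearMap.smul_apply, hF,
        thE_single, smul_eq_mul]
      rw [← hfth, hth]
    exact LinearMap.congr_fun (LinearMap.congr_fun this u) v
  have hFW : F *ᵥ (Wv k) = lam • Wv k := by
    rw [Wv, hF, hfW]
    simp [Wv]
  have hFx : ∀ u, thE k (F *ᵥ u) (Wv k) = thE k u (Wv k) := fun u => by
    have := hFth u (Wv k)
    rw [hFW, map_smul, smul_eq_mul] at this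
    exact mul_left_cancel₀ hlam this
  have hFS : p ^ 2 • (Fᵀ * S * F) = 1 := by
    ext i j
    obtain ⟨a, rfl⟩ := tau_surj k i
    obtain ⟨b, rfl⟩ := tau_surj k j
    have h1 : (Fᵀ * S * F) (tau k a) (tau k b)
        = ip (k + 1) S (F *ᵥ Pi.single (tau k a) 1) (F *ᵥ Pi.single (tau k b) 1) := by
      rw [ip, Matrix.mulVec_mulVec, Matrix.dotProduct_mulVec, ← Matrix.vecMul_transpose,
        Matrix.vecMul_vecMul, ← Matrix.mul_assoc]
      simp
    rw [Matrix.smul_apply, h1, hF, hF, ← hP', smul_eq_mul, hfin, Matrix.one_apply]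
    simp only [(tau_bij k).1.eq_iff]
  refine ⟨p ^ 2, F, by positivity, ⟨?_, ?_⟩, hFS⟩
  · have h1 : (p ^ 2 • (Fᵀ * S)) * F = 1 := by rw [Matrix.smul_mul, hFS]
    exact IsUnit.of_mul_eq_one_right _ h1
  · intro u v
    rw [bracket_eq, bracket_eq, hFx, hFx, hFth, Matrix.mulVec_add, Matrix.mulVec_sub,
      Matrix.mulVec_smul, Matrix.mulVec_smul, Matrix.mulVec_smul, hFW, smul_smul, mul_comm lam]

lemma isAut_mul_inv (n : ℕ) (F G : Matrix (Fin (2 * n)) (Fin (2 * n)) ℝ) (hF : IsAut n F)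
    (hG : IsAut n G) : IsAut n (F * G⁻¹) := by
  have hGd := (Matrix.isUnit_iff_isUnit_det _).1 hG.1
  have h1 : ∀ u, G *ᵥ (G⁻¹ *ᵥ u) = u := fun u => by
    rw [Matrix.mulVec_mulVec, Matrix.mul_nonsing_inv _ hGd, Matrix.one_mulVec]
  have h2 : ∀ u, G⁻¹ *ᵥ (G *ᵥ u) = u := fun u => by
    rw [Matrix.mulVec_mulVec, Matrix.nonsing_inv_mul _ hGd, Matrix.one_mulVec]
  refine ⟨hF.1.mul (Matrix.isUnit_nonsing_inv_iff.2 hG.1), fun u v => ?_⟩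
  simp only [← Matrix.mulVec_mulVec]
  rw [← hF.2]
  congr 1
  rw [← h2 (bracket n (G⁻¹ *ᵥ u) (G⁻¹ *ᵥ v)), hG.2, h1, h1]


/-- The Einstein left invariant metric on `CH(n)` is unique up to the action of
the automorphism group and scaling. -/
theorem einstein_unique (n : ℕ) (hn : 2 ≤ n)
    (S S' : Matrix (Fin (2 * n)) (Fin (2 * n)) ℝ)
    (hS : S.PosDef) (hS' : S'.PosDef)
    (hE : ∃ c : ℝ, ∀ i j, ricci n S (Pi.single i 1) (Pi.single j 1) = c * S i j)
    (hE' : ∃ c' : ℝ, ∀ i j, ricci n S' (Pi.single i 1) (Pi.single j 1) = c' * S' i j) :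
    ∃ (r : ℝ) (F : Matrix (Fin (2 * n)) (Fin (2 * n)) ℝ),
      0 < r ∧ IsAut n F ∧ S' = r • (F.transpose * S * F) := by
  obtain ⟨k, rfl⟩ : ∃ k, n = k + 1 := ⟨n - 1, by omega⟩
  obtain ⟨r, F, hr, hF, h1⟩ := exists_normal k S hS hE
  obtain ⟨r', G, hr', hG, h2⟩ := exists_normal k S' hS' hE'
  refine ⟨r / r', F * G⁻¹, by positivity, isAut_mul_inv _ F G hF hG, ?_⟩
  have hGd := (Matrix.isUnit_iff_isUnit_det _).1 hG.1
  have hGt : IsUnit (Gᵀ).det := by rwa [Matrix.det_transpose]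
  have h3 : S' = (G⁻¹)ᵀ * (Gᵀ * S' * G) * G⁻¹ := by
    rw [Matrix.transpose_nonsing_inv, Matrix.mul_assoc, Matrix.mul_assoc, Matrix.mul_assoc,
      Matrix.mul_nonsing_inv _ hGd, Matrix.mul_one, ← Matrix.mul_assoc,
      Matrix.nonsing_inv_mul _ hGt, Matrix.one_mul]
  have h4 : Gᵀ * S' * G = (r / r') • (Fᵀ * S * F) := by
    have : r' • (Gᵀ * S' * G) = r • (Fᵀ * S * F) := by rw [h1, h2]
    rw [div_eq_inv_mul, mul_smul, ← this, smul_smul, inv_mul_cancel₀ hr'.ne', one_smul]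
  rw [h3, h4, Matrix.transpose_mul]
  simp only [Matrix.smul_mul, Matrix.mul_smul, Matrix.mul_assoc]

end CHn
end
end

section
/- Every 2n×2n real matrix F of the block form F = [[1, 0, 0],[u, M, 0],[a, vᵀ, λ]] (blocks of sizes 1, 2n−2, 1), where M ∈ GL(2n−2, ℝ) satisfies MᵀJ_{n−1}M = λJ_{n−1}, λ ∈ ℝ with λ ≠ 0, a ∈ ℝ, v ∈ ℝ^{2n−2}, and u = (1/(2λ)) M J_{n−1} v, is the matrix in the ordered basis of a Lie algebra automorphism of 𝔠𝔥(n). -/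
noncomputable section

open Matrix BigOperators Finset

namespace CHn

/-- The middle index `p` of the ordered basis. -/
def mid (k : ℕ) (p : Fin (2 * k)) : Fin (2 * (k + 1)) := ⟨p.val + 1, by omega⟩
/-- The first index. -/
def fst0 (k : ℕ) : Fin (2 * (k + 1)) := ⟨0, by omega⟩
/-- The last index. -/
def lst0 (k : ℕ) : Fin (2 * (k + 1)) := ⟨2 * k + 1, by omega⟩

theorem sum_split_s4 (k : ℕ) (f : Fin (2 * (k + 1)) → ℝ) :
    ∑ i, f i = f (fst0 k) + ∑ p, f (mid k p) + f (lst0 k) := by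
  have h := Fin.sum_univ_castSucc (n := 2 * k + 1) f
  have h2 := Fin.sum_univ_succ (n := 2 * k) (fun i => f i.castSucc)
  exact h.trans (congrArg (· + f (lst0 k)) h2)

theorem idx_cases_s4 (k : ℕ) (i : Fin (2 * (k + 1))) :
    i = fst0 k ∨ (∃ p, i = mid k p) ∨ i = lst0 k := by
  rcases i with ⟨i, hi⟩
  by_cases h0 : i = 0
  · left; simp [fst0, h0]
  by_cases h1 : i = 2 * k + 1
  · right; right; simp [lst0, h1]
  · right; left
    exact ⟨⟨i - 1, by omega⟩, by simp only [mid, Fin.mk.injEq]; omega⟩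

theorem bracket_fst (k : ℕ) (x y : Fin (2 * (k + 1)) → ℝ) :
    bracket (k + 1) x y (fst0 k) = 0 := by
  unfold bracket
  refine Finset.sum_eq_zero fun i _ => Finset.sum_eq_zero fun j _ => ?_
  have : structC (k + 1) i j (fst0 k) = 0 := by
    unfold structC fst0
    simp only [Fin.ext_iff]
    repeat rw [if_neg (by omega)]
    norm_num
  rw [this, mul_zero]

theorem bracket_mid (k : ℕ) (x y : Fin (2 * (k + 1)) → ℝ) (p : Fin (2 * k)) :
    bracket (k + 1) x y (mid k p) =
      (1 / 2) * (x (fst0 k) * y (mid k p) - y (fst0 k) * x (mid k p)) := by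
  have hp := p.isLt
  have key : ∀ i j, structC (k + 1) i j (mid k p) =
      (if i = fst0 k then (if j = mid k p then (1 : ℝ) / 2 else 0) else 0)
      - (if i = mid k p then (if j = fst0 k then (1 : ℝ) / 2 else 0) else 0) := by
    intro i j
    unfold structC mid fst0
    simp only [Fin.ext_iff, ← ite_and]
    rw [if_neg (c := _ ∧ _ ∧ p.val + 1 = 2 * (k + 1) - 1) (by omega),
      if_neg (c := _ ∧ _ ∧ p.val + 1 = 2 * (k + 1) - 1) (by omega),
      if_neg (c := _ ∧ _ ∧ _ ∧ p.val + 1 = 2 * (k + 1) - 1) (by omega),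
      if_neg (c := _ ∧ _ ∧ _ ∧ p.val + 1 = 2 * (k + 1) - 1) (by omega)]
    simp only [sub_zero, add_zero]
    congr 1
    · exact if_congr (by omega) rfl rfl
    · exact if_congr (by omega) rfl rfl
  unfold bracket
  simp only [key, mul_sub, Finset.sum_sub_distrib, mul_ite, mul_zero, Finset.sum_ite_irrel,
    Finset.sum_const_zero, Finset.sum_ite_eq', Finset.mem_univ, if_true]
  ring

theorem structC_mm (k : ℕ) (p q : Fin (2 * k)) :
    structC (k + 1) (mid k p) (mid k q) (lst0 k) = - Jmat k p q := by
  have hp := p.isLt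
  have hq := q.isLt
  unfold structC mid lst0 Jmat
  simp only [Fin.ext_iff]
  split_ifs <;> first | omega | norm_num

theorem bracket_lst (k : ℕ) (x y : Fin (2 * (k + 1)) → ℝ) :
    bracket (k + 1) x y (lst0 k) =
      x (fst0 k) * y (lst0 k) - y (fst0 k) * x (lst0 k)
        - (fun p => x (mid k p)) ⬝ᵥ (Jmat k).mulVec (fun p => y (mid k p)) := by
  have h1 : structC (k + 1) (fst0 k) (fst0 k) (lst0 k) = 0 := by
    unfold structC fst0 lst0
    simp only [Fin.ext_iff, true_and]
    split_ifs <;> first | omega | (norm_num; done) | simp_all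
  have h2 : structC (k + 1) (fst0 k) (lst0 k) (lst0 k) = 1 := by
    unfold structC fst0 lst0
    simp only [Fin.ext_iff, true_and]
    split_ifs <;> first | omega | (norm_num; done) | simp_all
  have h3 : structC (k + 1) (lst0 k) (fst0 k) (lst0 k) = -1 := by
    unfold structC fst0 lst0
    simp only [Fin.ext_iff, true_and]
    split_ifs <;> first | omega | (norm_num; done) | simp_all
  have h4 : structC (k + 1) (lst0 k) (lst0 k) (lst0 k) = 0 := by
    unfold structC lst0
    simp only [Fin.ext_iff, true_and]
    split_ifs <;> first | omega | (norm_num; done) | simp_all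
  have h5 : ∀ p, structC (k + 1) (fst0 k) (mid k p) (lst0 k) = 0 := by
    intro p
    have hp := p.isLt
    unfold structC fst0 mid lst0
    simp only [Fin.ext_iff, true_and]
    split_ifs <;> first | omega | (norm_num; done) | simp_all
  have h6 : ∀ p, structC (k + 1) (mid k p) (fst0 k) (lst0 k) = 0 := by
    intro p
    have hp := p.isLt
    unfold structC fst0 mid lst0
    simp only [Fin.ext_iff, true_and]
    split_ifs <;> first | omega | (norm_num; done) | simp_all
  have h7 : ∀ p, structC (k + 1) (lst0 k) (mid k p) (lst0 k) = 0 := by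
    intro p
    have hp := p.isLt
    unfold structC mid lst0
    simp only [Fin.ext_iff, true_and]
    split_ifs <;> first | omega | (norm_num; done) | simp_all
  have h8 : ∀ p, structC (k + 1) (mid k p) (lst0 k) (lst0 k) = 0 := by
    intro p
    have hp := p.isLt
    unfold structC mid lst0
    simp only [Fin.ext_iff, true_and]
    split_ifs <;> first | omega | (norm_num; done) | simp_all
  unfold bracket
  simp only [sum_split_s4, h1, h2, h3, h4, h5, h6, h7, h8, structC_mm, dotProduct, mulVec,
    mul_zero, Finset.sum_const_zero, add_zero, zero_add, mul_neg, Finset.sum_neg_distrib,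
    Finset.mul_sum]
  simp only [mul_assoc, mul_left_comm, mul_comm]
  ring

section
variable (k : ℕ) (M : Matrix (Fin (2 * k)) (Fin (2 * k)) ℝ)
    (u v : Fin (2 * k) → ℝ) (a lam : ℝ) (x : Fin (2 * (k + 1)) → ℝ)

theorem mv_fst : (blockF (k + 1) M u v a lam).mulVec x (fst0 k) = x (fst0 k) := by
  simp only [mulVec, dotProduct, sum_split_s4]
  simp [blockF, fst0, mid, lst0]

theorem mv_mid (p : Fin (2 * k)) : (blockF (k + 1) M u v a lam).mulVec x (mid k p) =
    x (fst0 k) * u p + M.mulVec (fun q => x (mid k q)) p := by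
  have hp := p.isLt
  have e1 : blockF (k + 1) M u v a lam (mid k p) (fst0 k) = u p := by
    have : p.val + 1 ≤ 2 * (k + 1) - 2 := by omega
    simp [blockF, fst0, mid, this]
  have e2 : ∀ q, blockF (k + 1) M u v a lam (mid k p) (mid k q) = M p q := by
    intro q
    have : p.val + 1 ≤ 2 * (k + 1) - 2 := by omega
    have : q.val + 1 ≤ 2 * (k + 1) - 2 := by omega
    simp [blockF, mid, *]
  have e3 : blockF (k + 1) M u v a lam (mid k p) (lst0 k) = 0 := by
    have : ¬ (2 * k + 1 ≤ 2 * (k + 1) - 2) := by omega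
    have h3 : p.val + 1 ≤ 2 * (k + 1) - 2 := by omega
    simp [blockF, lst0, mid, this, h3]
  simp only [mulVec, dotProduct, sum_split_s4, e1, e2, e3]
  ring

theorem mv_lst : (blockF (k + 1) M u v a lam).mulVec x (lst0 k) =
    a * x (fst0 k) + v ⬝ᵥ (fun q => x (mid k q)) + lam * x (lst0 k) := by
  have hh : ¬ (2 * k + 1 ≤ 2 * (k + 1) - 2) := by omega
  have e1 : blockF (k + 1) M u v a lam (lst0 k) (fst0 k) = a := by
    simp [blockF, fst0, lst0, hh]
  have e2 : ∀ q, blockF (k + 1) M u v a lam (lst0 k) (mid k q) = v q := by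
    intro q
    have : q.val + 1 ≤ 2 * (k + 1) - 2 := by omega
    simp [blockF, lst0, mid, hh, this]
  have e3 : blockF (k + 1) M u v a lam (lst0 k) (lst0 k) = lam := by
    simp [blockF, lst0, hh]
  simp only [mulVec, dotProduct, sum_split_s4, e1, e2, e3]

end

theorem Jmat_transpose (k : ℕ) : (Jmat k)ᵀ = - Jmat k := by
  ext i j
  have := i.isLt
  have := j.isLt
  rw [transpose_apply, Matrix.neg_apply]
  simp only [Jmat]
  split_ifs <;> first | omega | norm_num

theorem Jmat_sq (k : ℕ) : Jmat k * Jmat k = -1 := by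
  ext i j
  have hi := i.isLt
  have hj := j.isLt
  rw [Matrix.mul_apply, Matrix.neg_apply, Matrix.one_apply]
  by_cases h : i.val < k
  · rw [Finset.sum_eq_single (⟨i.val + k, by omega⟩ : Fin (2 * k))]
    · simp only [Jmat, Fin.ext_iff]
      split_ifs <;> first | omega | norm_num
    · intro b _ hb
      have hb' : b.val ≠ i.val + k := fun h => hb (Fin.ext h)
      have := b.isLt
      simp only [Jmat]
      split_ifs <;> first | omega | norm_num
    · simp
  · rw [Finset.sum_eq_single (⟨i.val - k, by omega⟩ : Fin (2 * k))]
    · simp only [Jmat, Fin.ext_iff]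
      split_ifs <;> first | omega | norm_num
    · intro b _ hb
      have hb' : b.val ≠ i.val - k := fun h => hb (Fin.ext h)
      have := b.isLt
      simp only [Jmat]
      split_ifs <;> first | omega | norm_num
    · simp

theorem isAut_aux (k : ℕ)
    (M : Matrix (Fin (2 * k)) (Fin (2 * k)) ℝ)
    (u v : Fin (2 * k) → ℝ) (a lam : ℝ)
    (hM : IsUnit M) (hlam : lam ≠ 0)
    (hMJ : M.transpose * Jmat k * M = lam • Jmat k)
    (hu : u = (1 / (2 * lam)) • M.mulVec ((Jmat k).mulVec v)) :
    IsAut (k + 1) (blockF (k + 1) M u v a lam) := by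
  have hω : ∀ p q : Fin (2 * k) → ℝ,
      M.mulVec p ⬝ᵥ (Jmat k).mulVec (M.mulVec q) = lam * (p ⬝ᵥ (Jmat k).mulVec q) := by
    intro p q
    rw [← vecMul_transpose, ← dotProduct_mulVec, mulVec_mulVec, mulVec_mulVec,
      hMJ, smul_mulVec, dotProduct_smul, smul_eq_mul]
  have hanti : ∀ p q : Fin (2 * k) → ℝ,
      p ⬝ᵥ (Jmat k).mulVec q = - (q ⬝ᵥ (Jmat k).mulVec p) := by
    intro p q
    rw [dotProduct_comm, ← vecMul_transpose, Jmat_transpose, ← dotProduct_mulVec, neg_mulVec,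
      dotProduct_neg]
  have huv : ∀ q : Fin (2 * k) → ℝ,
      u ⬝ᵥ (Jmat k).mulVec (M.mulVec q) = (1 / 2) * (v ⬝ᵥ q) := by
    intro q
    rw [hu, smul_dotProduct, hω, hanti, mulVec_mulVec, Jmat_sq, neg_mulVec, one_mulVec,
      dotProduct_neg, dotProduct_comm q v, smul_eq_mul]
    field_simp
  have hmid : ∀ x : Fin (2 * (k + 1)) → ℝ,
      (fun p => (blockF (k + 1) M u v a lam).mulVec x (mid k p)) =
        x (fst0 k) • u + M.mulVec (fun q => x (mid k q)) := by
    intro x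
    funext p
    rw [mv_mid]
    simp
  have hbm : ∀ x y : Fin (2 * (k + 1)) → ℝ,
      (fun p => bracket (k + 1) x y (mid k p)) =
        (1 / 2 : ℝ) • (x (fst0 k) • (fun p => y (mid k p))
          - y (fst0 k) • (fun p => x (mid k p))) := by
    intro x y
    funext p
    rw [bracket_mid]
    simp
  refine ⟨?_, ?_⟩
  · rw [← mulVec_injective_iff_isUnit, ← coe_mulVecLin, ← LinearMap.ker_eq_bot,
      LinearMap.ker_eq_bot']
    intro x hx
    rw [mulVecLin_apply] at hx
    have h0 : x (fst0 k) = 0 := by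
      have := congrFun hx (fst0 k)
      rwa [mv_fst] at this
    have h1 : (fun q => x (mid k q)) = 0 := by
      apply mulVec_injective_iff_isUnit.2 hM
      have := hmid x
      rw [hx, h0, zero_smul, zero_add] at this
      rw [mulVec_zero, ← this]
      rfl
    have h2 : x (lst0 k) = 0 := by
      have := congrFun hx (lst0 k)
      rw [mv_lst, h0, h1] at this
      simpa [hlam] using this
    funext i
    rcases idx_cases_s4 k i with rfl | ⟨p, rfl⟩ | rfl
    · exact h0
    · exact congrFun h1 p
    · exact h2
  · intro x y
    funext i
    rcases idx_cases_s4 k i with rfl | ⟨p, rfl⟩ | rfl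
    · rw [mv_fst, bracket_fst, bracket_fst]
    · rw [mv_mid, bracket_mid, bracket_fst, mv_fst, mv_fst, mv_mid, mv_mid, hbm, mulVec_smul,
        mulVec_sub, mulVec_smul, mulVec_smul]
      simp only [Pi.smul_apply, Pi.sub_apply, smul_eq_mul]
      ring
    · rw [mv_lst, bracket_lst, bracket_lst, bracket_fst, mv_fst, mv_fst, mv_lst, mv_lst, hbm,
        hmid, hmid]
      have hu0 : u ⬝ᵥ (Jmat k).mulVec u = 0 := by
        have := hanti u u
        linarith
      simp only [mulVec_add, mulVec_smul, dotProduct_add, add_dotProduct, smul_dotProduct,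
        dotProduct_smul, dotProduct_sub, smul_eq_mul, hu0, huv, hω,
        hanti (M.mulVec _) u]
      ring

/-- Every block matrix `[[1,0,0],[u,M,0],[a,vᵀ,λ]]` with `M` invertible,
`MᵀJ_{n-1}M = λJ_{n-1}`, `λ ≠ 0` and `u = (1/(2λ)) M J_{n-1} v` is the matrix of
a Lie algebra automorphism of `𝔠𝔥(n)`. -/
theorem isAut_blockF (n : ℕ) (hn : 2 ≤ n)
    (M : Matrix (Fin (2 * (n - 1))) (Fin (2 * (n - 1))) ℝ)
    (u v : Fin (2 * (n - 1)) → ℝ) (a lam : ℝ)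
    (hM : IsUnit M) (hlam : lam ≠ 0)
    (hMJ : M.transpose * Jmat (n - 1) * M = lam • Jmat (n - 1))
    (hu : u = (1 / (2 * lam)) • M.mulVec ((Jmat (n - 1)).mulVec v)) :
    IsAut n (blockF n M u v a lam) := by
  obtain ⟨k, rfl⟩ : ∃ k, n = k + 1 := ⟨n - 1, by omega⟩
  exact isAut_aux k M u v a lam hM hlam hMJ hu

end CHn
end
end
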